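/- arXiv:1005.1297 — 12 statements merged into one kernel-verified Lean document; each statement's English description precedes it below -/
import Mathlib

section
/- Let n = 2^D + m with 0 ≤ m < 2^D. Then the binomial coefficient C(n,m) is odd, and C(n,r) is even for every r satisfying m < r < 2^D. -/
/-- A power of a prime larger than `r` may be dropped from the top of `n.choose r` mod `p`. -/
theorem Nat.choose_prime_pow_add_modEq {p : ℕ} (hp : p.Prime) {k r : ℕ} (m : ℕ)
    (hr : r < p ^ k) : (p ^ k + m).choose r ≡ m.choose r [MOD p] := by
  rw [Nat.add_choose_eq, Finset.Nat.sum_antidiagonal_eq_sum_range_succ_mk,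
    Finset.sum_range_succ']
  have h : p ∣ ∑ i ∈ Finset.range r, (p ^ k).choose (i + 1) * m.choose (r - (i + 1)) := by
    refine Finset.dvd_sum fun i hi => Dvd.dvd.mul_right ?_ _
    have := Finset.mem_range.mp hi
    exact hp.dvd_choose_pow (by lia) (by lia)
  simpa using (Nat.modEq_zero_iff_dvd.mpr h).add_right (m.choose r)

/-- Let `n = 2^D + m` with `0 ≤ m < 2^D`. Then `C(n, m)` is odd, and `C(n, r)` is even
for every `r` with `m < r < 2^D`. -/
theorem stmt0 (D m n : ℕ) (hn : n = 2 ^ D + m) (hm : m < 2 ^ D) :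
    Odd (n.choose m) ∧ ∀ r : ℕ, m < r → r < 2 ^ D → Even (n.choose r) := by
  subst hn
  refine ⟨?_, fun r hmr hr => ?_⟩
  · have h := Nat.choose_prime_pow_add_modEq Nat.prime_two m hm
    rw [Nat.choose_self] at h
    exact Nat.odd_iff.mpr h
  · have h := Nat.choose_prime_pow_add_modEq Nat.prime_two m hr
    rw [Nat.choose_eq_zero_of_lt hmr] at h
    exact Nat.even_iff.mpr h
end

section
/- Let X be a metric space and E a topological real line bundle over X. Suppose there are open sets X₀, X₁ ⊆ X with X₀ ∪ X₁ = X such that E admits a local trivialization whose base set is X₀ and a local trivialization whose base set is X₁. Then there exist continuous global sections s₀, s₁ of E such that for every x ∈ X at least one of s₀(x), s₁(x) is nonzero (equivalently, there exists a fiberwise-linear epimorphism from the trivial rank-2 bundle ε²_X onto E). -/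
open Bundle Topology

/-- A continuous function supported in the base set of a linear trivialization of a vector bundle,
read as a section over that base set, extends by zero to a continuous global section. -/
theorem Bundle.Trivialization.continuous_mk_symmₗ_of_tsupport_subset
    {R B F : Type*} {E : B → Type*} [NontriviallyNormedField R] [TopologicalSpace B]
    [NormedAddCommGroup F] [NormedSpace R F]
    [∀ x, TopologicalSpace (E x)] [∀ x, AddCommGroup (E x)] [∀ x, Module R (E x)]
    [TopologicalSpace (TotalSpace F E)] [FiberBundle F E] [VectorBundle R F E]
    (e : Trivialization F (π F E)) [e.IsLinear R] {f : B → F} (hf : Continuous f)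
    (hsupp : tsupport f ⊆ e.baseSet) :
    Continuous (fun x => (TotalSpace.mk x (e.symmₗ R x (f x)) : TotalSpace F E)) := by
  rw [continuous_iff_continuousAt]
  intro x
  by_cases hx : x ∈ e.baseSet
  · have hcont : ContinuousAt (fun y => e.toOpenPartialHomeomorph.symm (y, f y)) x :=
      ContinuousAt.comp (f := fun y => (y, f y))
        (e.toOpenPartialHomeomorph.symm.continuousAt (e.mem_target.2 hx))
        (continuousAt_id.prodMk hf.continuousAt)
    refine hcont.congr ?_
    filter_upwards [e.open_baseSet.mem_nhds hx] with y hy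
    rw [e.symmₗ_apply hy, e.mk_symm hy]
  · refine (continuous_zeroSection (F := F) (E := E) R).continuousAt.congr ?_
    filter_upwards [(isClosed_tsupport f).isOpen_compl.mem_nhds fun h => hx (hsupp h)] with y hy
    rw [image_eq_zero_of_notMem_tsupport hy, map_zero]
    rfl

/-- Let `X` be a metric space and `E` a topological real line bundle over `X`.  Suppose
`X₀ ∪ X₁ = X` are open sets over which `E` admits (fiberwise linear) trivializations.
Then there are two continuous global sections of `E` with no common zero (equivalently,
a fiberwise-linear epimorphism `ε²_X → E`). -/
theorem stmt2 {X : Type*} [MetricSpace X] (E : X → Type*)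
    [∀ x, TopologicalSpace (E x)] [∀ x, AddCommGroup (E x)] [∀ x, Module ℝ (E x)]
    [TopologicalSpace (TotalSpace ℝ E)] [FiberBundle ℝ E] [VectorBundle ℝ ℝ E]
    (e₀ e₁ : Trivialization ℝ (π ℝ E)) [e₀.IsLinear ℝ] [e₁.IsLinear ℝ]
    (hcover : e₀.baseSet ∪ e₁.baseSet = Set.univ) :
    ∃ s₀ s₁ : (x : X) → E x,
      Continuous (fun x => (TotalSpace.mk x (s₀ x) : TotalSpace ℝ E)) ∧
      Continuous (fun x => (TotalSpace.mk x (s₁ x) : TotalSpace ℝ E)) ∧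
      ∀ x : X, s₀ x ≠ 0 ∨ s₁ x ≠ 0 := by
  obtain ⟨p, hp⟩ := PartitionOfUnity.exists_isSubordinate (s := (Set.univ : Set X)) isClosed_univ
    (fun b : Bool => (cond b e₀ e₁).baseSet) (fun b => (cond b e₀ e₁).open_baseSet)
    (by rw [← hcover, Set.union_eq_iUnion]
        exact Set.iUnion_mono fun b => by cases b <;> exact subset_rfl)
  have symmₗ_ne_zero {e : Trivialization ℝ (π ℝ E)} [e.IsLinear ℝ] {b : Bool} {x : X}
      (hb : tsupport (p b) ⊆ e.baseSet) (hx : p b x ≠ 0) : e.symmₗ ℝ x (p b x) ≠ 0 := by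
    intro h
    have hmap := e.linearMapAt_symmₗ (R := ℝ) (hb (subset_tsupport _ hx)) (p b x)
    rw [h, map_zero] at hmap
    exact hx hmap.symm
  refine ⟨fun x => e₀.symmₗ ℝ x (p true x), fun x => e₁.symmₗ ℝ x (p false x),
    e₀.continuous_mk_symmₗ_of_tsupport_subset (p true).continuous (hp true),
    e₁.continuous_mk_symmₗ_of_tsupport_subset (p false).continuous (hp false), fun x => ?_⟩
  obtain ⟨b, hb⟩ := p.exists_pos (Set.mem_univ x)
  cases b
  · exact Or.inr (symmₗ_ne_zero (hp false) hb.ne')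
  · exact Or.inl (symmₗ_ne_zero (hp true) hb.ne')
end

section
/- Let n = 2^D + m with 0 ≤ m < 2^D − 2. Suppose l is a natural number such that the equations w_a·w_b = w_c·w_d hold in (ℤ/2)[x]/(x^{n+1}) for all natural numbers a, b, c, d ≥ l with a + b = c + d. Then l ≥ m + 1. -/
/-- The truncated polynomial ring `(ℤ/2)[x]/(x^(n+1))`, i.e. the mod 2 cohomology ring
of `ℝPⁿ`. -/
abbrev TruncRing (n : ℕ) : Type :=
  Polynomial (ZMod 2) ⧸ Ideal.span {(Polynomial.X : Polynomial (ZMod 2)) ^ (n + 1)}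

/-- `w n j` is the `j`-th Stiefel–Whitney class `C(n+1, j) * x^j` of the tangent bundle of
`ℝPⁿ`, viewed in `(ℤ/2)[x]/(x^(n+1))`. -/
noncomputable def w (n j : ℕ) : TruncRing n :=
  Ideal.Quotient.mk _ (Polynomial.C (((n + 1).choose j : ℕ) : ZMod 2) * Polynomial.X ^ j)

/-- In characteristic `2`, adding `2 ^ D` to the upper index does not change the binomial
coefficients with lower index below `2 ^ D`. -/
theorem cast_choose_two_pow_add {D j : ℕ} (M : ℕ) (hj : j < 2 ^ D) :
    (((2 ^ D + M).choose j : ℕ) : ZMod 2) = (M.choose j : ℕ) := by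
  rw [← Polynomial.coeff_one_add_X_pow, pow_add, add_pow_char_pow, one_pow, add_mul, one_mul,
    Polynomial.coeff_add, Polynomial.coeff_one_add_X_pow, Polynomial.coeff_X_pow_mul',
    if_neg (by omega), add_zero]

/-- Low powers of the generator are nonzero in the truncated polynomial ring. -/
theorem mk_X_pow_ne_zero {n k : ℕ} (hk : k ≤ n) :
    (Ideal.Quotient.mk _ (Polynomial.X ^ k) : TruncRing n) ≠ 0 := by
  rw [Ne, Ideal.Quotient.eq_zero_iff_mem, Ideal.mem_span_singleton, Polynomial.X_pow_dvd_iff]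
  intro h
  simpa using h k (by omega)

/-- Let `n = 2^D + m` with `0 ≤ m < 2^D - 2`.  If `l` is such that `w_a * w_b = w_c * w_d`
holds in `H^*(ℝPⁿ; ℤ/2)` for all `a, b, c, d ≥ l` with `a + b = c + d`, then `l ≥ m + 1`. -/
theorem stmt3 (D m n : ℕ) (hn : n = 2 ^ D + m) (hm : m < 2 ^ D - 2) (l : ℕ)
    (hrel : ∀ a b c d : ℕ, l ≤ a → l ≤ b → l ≤ c → l ≤ d → a + b = c + d →
      w n a * w n b = w n c * w n d) :
    m + 1 ≤ l := by
  by_contra! hl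
  have hchoose : ∀ j < 2 ^ D, (((n + 1).choose j : ℕ) : ZMod 2) = ((m + 1).choose j : ℕ) := by
    intro j hj
    rw [hn, add_assoc, cast_choose_two_pow_add _ hj]
  have hM : w n (m + 1) = Ideal.Quotient.mk _ (Polynomial.X ^ (m + 1)) := by
    rw [w, hchoose _ (by omega)]
    simp
  have hS : w n (m + 2) = 0 := by
    rw [w, hchoose _ (by omega)]
    simp
  have h := hrel (m + 1) (m + 1) (m + 2) m (by omega) (by omega) (by omega) (by omega) (by omega)
  rw [hS, zero_mul, hM, ← map_mul, ← pow_add] at h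
  exact mk_X_pow_ne_zero (by omega) h
end

section
/- Let n = 2^D + m with 0 ≤ m < 2^D − 2. Then the relations ∏_{i∈I} w_i = ∏_{j∈J} w_j hold in (ℤ/2)[x]/(x^{n+1}) for all finite multisets I, J of natural numbers in {m+1, …, n} which satisfy |I| = |J| and Σ_{i∈I} i = Σ_{j∈J} j. -/
theorem two_dvd_choose_two_pow_add {D a j : ℕ} (haj : a < j) (hj : j < 2 ^ D) :
    2 ∣ (2 ^ D + a).choose j := by
  rw [Nat.add_choose_eq]
  refine Finset.dvd_sum fun p hp => ?_
  rw [Finset.HasAntidiagonal.mem_antidiagonal] at hp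
  rcases Nat.eq_zero_or_pos p.1 with h0 | h0
  · rw [Nat.choose_eq_zero_of_lt (show a < p.2 by omega), mul_zero]
    exact dvd_zero 2
  · exact (Nat.prime_two.dvd_choose_pow h0.ne' (by omega)).mul_right _

theorem w_eq_zero_of_two_dvd {n j : ℕ} (h : 2 ∣ (n + 1).choose j) : w n j = 0 := by
  rw [w, (ZMod.natCast_eq_zero_iff _ 2).2 h, Polynomial.C_0, zero_mul, map_zero]

theorem exists_prod_map_w_eq (n : ℕ) (I : Multiset ℕ) :
    ∃ c : ZMod 2, (I.map (w n)).prod =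
      Ideal.Quotient.mk _ (Polynomial.C c * Polynomial.X ^ I.sum) := by
  induction I using Multiset.induction with
  | empty => exact ⟨1, by simp⟩
  | cons i s ih =>
    obtain ⟨c, hc⟩ := ih
    refine ⟨((n + 1).choose i : ℕ) * c, ?_⟩
    rw [Multiset.map_cons, Multiset.prod_cons, Multiset.sum_cons, hc, w, ← map_mul]
    congr 1
    rw [Polynomial.C_mul, pow_add, mul_mul_mul_comm]

theorem prod_map_w_eq_zero_of_lt_sum {n : ℕ} {I : Multiset ℕ} (h : n < I.sum) :
    (I.map (w n)).prod = 0 := by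
  obtain ⟨c, hc⟩ := exists_prod_map_w_eq n I
  rw [hc, Ideal.Quotient.eq_zero_iff_mem, Ideal.mem_span_singleton]
  exact (pow_dvd_pow _ h).mul_left _

theorem Multiset.eq_replicate_of_sum_le {a : ℕ} {I : Multiset ℕ} (h : ∀ i ∈ I, a ≤ i)
    (hsum : I.sum ≤ I.card * a) : I = Multiset.replicate I.card a := by
  refine Multiset.eq_replicate.2 ⟨rfl, fun i hi => ?_⟩
  obtain ⟨t, rfl⟩ := Multiset.exists_cons_of_mem hi
  have ht := Multiset.card_nsmul_le_sum (s := t) (a := a)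
    fun x hx => h x (Multiset.mem_cons_of_mem hx)
  rw [Multiset.sum_cons, Multiset.card_cons, add_mul] at hsum
  rw [smul_eq_mul] at ht
  have := h i hi
  omega

theorem prod_map_w_eq_zero {D m : ℕ} {I : Multiset ℕ} (hI : ∀ i ∈ I, m + 1 ≤ i)
    (hcard : 2 ≤ I.card) (hsum : I.card * (m + 1) < I.sum) :
    (I.map (w (2 ^ D + m))).prod = 0 := by
  by_cases hn : 2 ^ D + m < I.sum
  · exact prod_map_w_eq_zero_of_lt_sum hn
  obtain ⟨i, hi, hne⟩ : ∃ i ∈ I, i ≠ m + 1 := by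
    by_contra! hall
    have hs := congrArg Multiset.sum (Multiset.eq_replicate.2 ⟨rfl, hall⟩)
    rw [Multiset.sum_replicate, smul_eq_mul] at hs
    omega
  have hlt : i < 2 ^ D := by
    obtain ⟨t, rfl⟩ := Multiset.exists_cons_of_mem hi
    rw [Multiset.card_cons] at hcard
    obtain ⟨j, hj⟩ := Multiset.card_pos_iff_exists_mem.1 (show 0 < t.card by omega)
    have hjt := Multiset.le_sum_of_mem hj
    have := hI j (Multiset.mem_cons_of_mem hj)
    rw [Multiset.sum_cons] at hn
    omega
  refine Multiset.prod_eq_zero (Multiset.mem_map.2 ⟨i, hi, w_eq_zero_of_two_dvd ?_⟩)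
  have := hI i hi
  exact two_dvd_choose_two_pow_add (a := m + 1) (by omega) hlt

/-- Let `n = 2^D + m` with `0 ≤ m < 2^D - 2`.  Then `∏_{i ∈ I} w_i = ∏_{j ∈ J} w_j` holds in
`H^*(ℝPⁿ; ℤ/2)` for all finite multisets `I, J` of natural numbers in `{m+1, …, n}` with
`|I| = |J|` and `Σ_{i ∈ I} i = Σ_{j ∈ J} j`. -/
theorem stmt4 (D m n : ℕ) (hn : n = 2 ^ D + m) (hm : m < 2 ^ D - 2)
    (I J : Multiset ℕ)
    (hI : ∀ i ∈ I, m + 1 ≤ i ∧ i ≤ n) (hJ : ∀ j ∈ J, m + 1 ≤ j ∧ j ≤ n)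
    (hcard : Multiset.card I = Multiset.card J) (hsum : I.sum = J.sum) :
    (I.map (w n)).prod = (J.map (w n)).prod := by
  subst hn
  have hI' := fun i hi => (hI i hi).1
  have hJ' := fun j hj => (hJ j hj).1
  rcases Nat.lt_or_ge I.card 2 with hc | hc
  · interval_cases h : I.card
    · rw [Multiset.card_eq_zero.1 h, Multiset.card_eq_zero.1 hcard.symm]
    · obtain ⟨i, rfl⟩ := Multiset.card_eq_one.1 h
      obtain ⟨j, rfl⟩ := Multiset.card_eq_one.1 hcard.symm
      rw [Multiset.sum_singleton, Multiset.sum_singleton] at hsum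
      rw [hsum]
  rcases Nat.lt_or_ge (I.card * (m + 1)) I.sum with hs | hs
  · rw [prod_map_w_eq_zero hI' hc hs,
      prod_map_w_eq_zero hJ' (hcard ▸ hc) (by rwa [← hcard, ← hsum])]
  · rw [Multiset.eq_replicate_of_sum_le hI' hs,
      Multiset.eq_replicate_of_sum_le hJ' (by rwa [← hcard, ← hsum]), hcard]
end

section
/- Let n be an odd positive integer and let h be an integer with 1 ≤ h ≤ (n−1)/2 such that h is not a power of 2, and let u ≥ 0 be the integer with 2^u < h < 2^{u+1}. Then there exists a polynomial P ∈ 𝓡₊ such that P + x^h·t^{n−2h} lies in the ℤ/2-linear span of the monomials x^α·t^{n−2α} with 2^u ≤ α ≤ h−1. -/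
open MvPolynomial

/-- The polynomial `R_n(s, m) ∈ (ℤ/2)[x, t]` (with `x = X 0`, `t = X 1`):
`R_n(s,m) = Σ_i C(m,i)·C(s+1+m−i, n−2m−2i−2−s)·x^(m+1+i)·t^(n−2m−2i−2)`,
the sum running over `0 ≤ i ≤ m` with `n − 2m − 2i − 2 ≥ 0`, with the convention that a
binomial coefficient `C(α,β)` is `0` whenever `β < 0` or `α < β`. -/
noncomputable def Rpoly (n s m : ℕ) : MvPolynomial (Fin 2) (ZMod 2) :=
  ∑ i ∈ Finset.range (m + 1),
    if 2 * m + 2 * i + 2 ≤ n then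
      (if s ≤ n - (2 * m + 2 * i + 2) then
          ((m.choose i * (s + 1 + m - i).choose (n - (2 * m + 2 * i + 2) - s) : ℕ) : ZMod 2)
        else 0) •
        (X 0 ^ (m + 1 + i) * X 1 ^ (n - (2 * m + 2 * i + 2)))
    else 0

/-- `𝓡₊`: the `ℤ/2`-linear span of the polynomials `R_n(s, m)` for `(s, m) ∈ V_R`,
i.e. `s, m ≥ 0` and `s + 2m + 2 ≤ n - 1`. -/
noncomputable def Rplus (n : ℕ) : Submodule (ZMod 2) (MvPolynomial (Fin 2) (ZMod 2)) :=
  Submodule.span (ZMod 2) {p | ∃ s m : ℕ, s + 2 * m + 2 ≤ n - 1 ∧ p = Rpoly n s m}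

/-- `R₀ = Σ_{1 ≤ j ≤ n/2} C(n−j−1, n−2j)·x^j·t^(n−2j) ∈ (ℤ/2)[x, t]`. -/
noncomputable def Rzero (n : ℕ) : MvPolynomial (Fin 2) (ZMod 2) :=
  ∑ j ∈ Finset.Icc 1 (n / 2),
    (((n - j - 1).choose (n - 2 * j) : ℕ) : ZMod 2) • (X 0 ^ j * X 1 ^ (n - 2 * j))

theorem odd_choose_two_pow_sub_one (u i : ℕ) (hi : i < 2 ^ u) : Odd ((2 ^ u - 1).choose i) := by
  induction i with
  | zero => simp
  | succ i ih =>
    have hdvd : 2 ∣ (2 ^ u).choose (i + 1) :=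
      Nat.prime_two.dvd_choose_pow (Nat.succ_ne_zero i) hi.ne
    have hpascal : (2 ^ u).choose (i + 1) =
        (2 ^ u - 1).choose i + (2 ^ u - 1).choose (i + 1) := by
      rw [← Nat.choose_succ_succ', Nat.sub_add_cancel Nat.one_le_two_pow]
    have hodd := ih (by omega)
    rw [hpascal] at hdvd
    rw [Nat.odd_iff] at hodd ⊢
    omega

/-- For an admissible monomial `x^h·t^(n−2h)` (i.e. `h` not a power of `2`) with
`1 ≤ h ≤ (n−1)/2` and `2^u < h < 2^(u+1)`, there is an element `P ∈ 𝓡₊` such that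
`P + x^h·t^(n−2h)` is a `ℤ/2`-linear combination of the monomials `x^α·t^(n−2α)` with
`2^u ≤ α ≤ h − 1`. -/
theorem stmt6 (n h u : ℕ) (hn : Odd n) (hpos : 0 < n)
    (h1 : 1 ≤ h) (h2 : h ≤ (n - 1) / 2)
    (hnotpow : ¬ ∃ k : ℕ, h = 2 ^ k)
    (hu1 : 2 ^ u < h) (hu2 : h < 2 ^ (u + 1)) :
    ∃ P ∈ Rplus n,
      P + X 0 ^ h * X 1 ^ (n - 2 * h) ∈
        Submodule.span (ZMod 2)
          {q : MvPolynomial (Fin 2) (ZMod 2) |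
            ∃ α : ℕ, 2 ^ u ≤ α ∧ α ≤ h - 1 ∧ q = X 0 ^ α * X 1 ^ (n - 2 * α)} := by
  have hpow : 1 ≤ 2 ^ u := Nat.one_le_two_pow
  rw [pow_succ] at hu2
  have hm : 2 ^ u - 1 + 1 = 2 ^ u := Nat.sub_add_cancel hpow
  refine ⟨Rpoly n (n - 2 * h) (2 ^ u - 1),
    Submodule.subset_span ⟨n - 2 * h, 2 ^ u - 1, by omega, rfl⟩, ?_⟩
  have hlead : (((2 ^ u - 1).choose (h - 2 ^ u) : ℕ) : ZMod 2) = 1 :=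
    ZMod.natCast_eq_one_iff_odd.mpr (odd_choose_two_pow_sub_one u _ (by omega))
  have hdeg : 2 * (2 ^ u - 1) + 2 * (h - 2 ^ u) + 2 = 2 * h := by omega
  have hexp : 2 ^ u - 1 + 1 + (h - 2 ^ u) = h := by omega
  rw [Rpoly, ← Finset.add_sum_erase _ _
    (Finset.mem_range.mpr (by omega : h - 2 ^ u < 2 ^ u - 1 + 1)), hdeg, hexp,
    if_pos (by omega), if_pos le_rfl, Nat.sub_self, Nat.choose_zero_right, mul_one, hlead,
    one_smul, add_right_comm, CharTwo.add_self_eq_zero, zero_add]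
  refine Submodule.sum_mem _ fun i hi => ?_
  rw [Finset.mem_erase, Finset.mem_range] at hi
  split_ifs with hle hs
  · refine Submodule.smul_mem _ _ (Submodule.subset_span ⟨2 ^ u - 1 + 1 + i, ?_, ?_, ?_⟩)
    · omega
    · omega
    · congr 3
      omega
  · rw [zero_smul]
    exact Submodule.zero_mem _
  · exact Submodule.zero_mem _
end

section
/- Let n be an odd positive integer, let 1 ≤ h ≤ (n−1)/2, and let u ≥ 0 be the greatest integer such that 2^u ≤ h. Then x^h·t^{n−2h} ∈ 𝓡₊ or x^h·t^{n−2h} + x^{2^u}·t^{n−2^{u+1}} ∈ 𝓡₊. -/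
open MvPolynomial

theorem odd_choose_two_pow (k r : ℕ) (hr : 1 ≤ r) :
    Odd ((2 ^ (k + 1) * r - 1).choose (2 ^ k)) := by
  induction k with
  | zero => exact ⟨r - 1, by simp; omega⟩
  | succ k ih =>
    have hlucas := Choose.choose_modEq_choose_mod_mul_choose_div_nat
      (n := 2 ^ (k + 1 + 1) * r - 1) (k := 2 ^ (k + 1)) (p := 2)
    have hpos : 0 < 2 ^ (k + 1) * r := by positivity
    have hn : 2 ^ (k + 1 + 1) * r = 2 * (2 ^ (k + 1) * r) := by ring
    have hmod : (2 ^ (k + 1 + 1) * r - 1) % 2 = 1 := by omega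
    have hdiv : (2 ^ (k + 1 + 1) * r - 1) / 2 = 2 ^ (k + 1) * r - 1 := by omega
    have hmod' : 2 ^ (k + 1) % 2 = 0 := by omega
    have hdiv' : 2 ^ (k + 1) / 2 = 2 ^ k := by omega
    rw [hmod, hdiv, hmod', hdiv', Nat.choose_zero_right, one_mul] at hlucas
    exact Nat.odd_iff.mpr (Eq.trans hlucas (Nat.odd_iff.mp ih))

/-- If `C(g-1, h-g)` is odd, then `R_n(n-2h, g-1)` has leading monomial `x^h t^(n-2h)`, all other
monomials being `x^j t^(n-2j)` with `g ≤ j < h`. -/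
theorem monomial_mem_of_odd_choose {n g h : ℕ} (hg : 1 ≤ g) (hgh : g < h) (hhn : 2 * h ≤ n)
    (hodd : Odd ((g - 1).choose (h - g)))
    {S : Submodule (ZMod 2) (MvPolynomial (Fin 2) (ZMod 2))} (hS : Rplus n ≤ S)
    (hlt : ∀ j, g ≤ j → j < h → X 0 ^ j * X 1 ^ (n - 2 * j) ∈ S) :
    X 0 ^ h * X 1 ^ (n - 2 * h) ∈ S := by
  have hle : h - g ≤ g - 1 := by
    by_contra hcon
    rw [Nat.choose_eq_zero_of_lt (by omega)] at hodd
    exact absurd hodd (by decide)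
  have hR : Rpoly n (n - 2 * h) (g - 1) ∈ S :=
    hS (Submodule.subset_span ⟨n - 2 * h, g - 1, by omega, rfl⟩)
  have hmem : h - g ∈ Finset.range (g - 1 + 1) := Finset.mem_range.mpr (by omega)
  rw [Rpoly, ← Finset.add_sum_erase _ _ hmem, Submodule.add_mem_iff_left] at hR
  · have hexp : n - (2 * (g - 1) + 2 * (h - g) + 2) = n - 2 * h := by omega
    have hdeg : g - 1 + 1 + (h - g) = h := by omega
    rw [if_pos (by omega), hexp, if_pos le_rfl, hdeg, Nat.sub_self, Nat.choose_zero_right,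
      mul_one, ZMod.natCast_eq_one_iff_odd.mpr hodd, one_smul] at hR
    exact hR
  · refine Submodule.sum_mem _ fun i hi => ?_
    obtain ⟨hne, hi⟩ := Finset.mem_erase.mp hi
    split_ifs with hin hs
    · have hexp : n - (2 * (g - 1) + 2 * i + 2) = n - 2 * (g + i) := by omega
      have hdeg : g - 1 + 1 + i = g + i := by omega
      rw [hexp, hdeg]
      exact S.smul_mem _ (hlt _ (by omega) (by omega))
    · rw [zero_smul]
      exact S.zero_mem
    · exact S.zero_mem

theorem monomial_mem_Rplus_sup_span (n u : ℕ) :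
    ∀ h, 2 * h ≤ n → 2 ^ u ≤ h → (∀ v : ℕ, 2 ^ v ≤ h → v ≤ u) →
      X 0 ^ h * X 1 ^ (n - 2 * h) ∈
        Rplus n ⊔ Submodule.span (ZMod 2) {X 0 ^ (2 ^ u) * X 1 ^ (n - 2 * 2 ^ u)} := by
  intro h
  induction h using Nat.strong_induction_on with
  | _ h ih =>
  intro hhn hu humax
  have hupos : 0 < 2 ^ u := by positivity
  obtain ⟨k, q, hq, rfl⟩ := Nat.exists_eq_two_pow_mul_odd (n := h) (by omega)
  obtain ⟨r, rfl⟩ := hq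
  have hkpos : 0 < 2 ^ k := by positivity
  have hk : k ≤ u := humax k (Nat.le_mul_of_pos_right _ (by omega))
  have hsplit : 2 ^ k * (2 * r + 1) = 2 ^ (k + 1) * r + 2 ^ k := by ring
  rcases Nat.eq_zero_or_pos r with rfl | hr
  · have huk : u = k :=
      le_antisymm ((Nat.pow_le_pow_iff_right Nat.one_lt_two).mp (by simpa using hu)) hk
    subst huk
    refine Submodule.mem_sup_right (Submodule.subset_span ?_)
    simp
  · have hug : 2 ^ u ≤ 2 ^ (k + 1) * r := by
      rcases hk.eq_or_lt with rfl | hlt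
      · rw [pow_succ]; nlinarith
      · obtain ⟨d, rfl⟩ := Nat.exists_eq_add_of_le (Nat.succ_le_of_lt hlt)
        have h2 : 2 ^ (k.succ + d) = 2 ^ k * (2 * 2 ^ d) := by rw [Nat.succ_eq_add_one]; ring
        rw [h2] at hu
        have hd := Nat.le_of_mul_le_mul_left hu hkpos
        rw [h2, pow_succ, mul_assoc]
        exact Nat.mul_le_mul_left _ (by omega)
    refine monomial_mem_of_odd_choose (g := 2 ^ (k + 1) * r) (by omega) (by omega) hhn ?_
      le_sup_left fun j hgj hjh =>
        ih j hjh (by omega) (by omega) fun v hv => humax v (by omega)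
    rw [hsplit, Nat.add_sub_cancel_left]
    exact odd_choose_two_pow k r hr

/-- Let `n` be odd, `1 ≤ h ≤ (n−1)/2`, and let `u` be the greatest integer with `2^u ≤ h`.
Then `x^h·t^(n−2h) ∈ 𝓡₊` or `x^h·t^(n−2h) + x^(2^u)·t^(n−2^(u+1)) ∈ 𝓡₊`. -/
theorem stmt7 (n h u : ℕ) (hn : Odd n) (hpos : 0 < n)
    (h1 : 1 ≤ h) (h2 : h ≤ (n - 1) / 2)
    (hu : 2 ^ u ≤ h) (humax : ∀ v : ℕ, 2 ^ v ≤ h → v ≤ u) :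
    X 0 ^ h * X 1 ^ (n - 2 * h) ∈ Rplus n ∨
    X 0 ^ h * X 1 ^ (n - 2 * h) + X 0 ^ (2 ^ u) * X 1 ^ (n - 2 ^ (u + 1)) ∈ Rplus n := by
  have hmem := monomial_mem_Rplus_sup_span n u h (by omega) hu humax
  obtain ⟨p, hp, q, hq, hpq⟩ := Submodule.mem_sup.mp hmem
  obtain ⟨c, rfl⟩ := Submodule.mem_span_singleton.mp hq
  rw [pow_succ', ← hpq]
  have hc : c = 0 ∨ c = 1 := (by decide : ∀ a : ZMod 2, a = 0 ∨ a = 1) c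
  rcases hc with rfl | rfl
  · left
    simpa using hp
  · right
    rwa [one_smul, add_assoc, CharTwo.add_self_eq_zero, add_zero]
end

section
/- Let n = 2^a + 2^b − 1 with integers a > b > 0, and let u = a−1 or u = b. Then for every (s,m) ∈ V_R, the coefficient of the monomial x^{2^u}·t^{n−2^{u+1}} in R_n(s,m) is 0; equivalently, C(m, 2^u−1−m)·C(2m+2−2^u+s, n−2^{u+1}−s) is even for all (s,m) ∈ V_R. -/
open MvPolynomial

/-- The binomial coefficient `C(a, b)` for integer arguments, with the convention that it is
`0` whenever `b < 0` or `a < b`. -/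
def Cz (a b : ℤ) : ℕ := if 0 ≤ b ∧ b ≤ a then a.toNat.choose b.toNat else 0

/-- If `2 ^ k` divides `p + q + 1` and `0 < q < 2 ^ k`, then the binary digits of `q` below
position `k` are complementary to those of `p`, so `p.choose q` is even. -/
theorem even_choose_of_two_pow_dvd_add_add_one (k : ℕ) :
    ∀ p q : ℕ, 2 ^ k ∣ p + q + 1 → 0 < q → q < 2 ^ k → Even (p.choose q) := by
  induction k with
  | zero => intro p q _ hq hq'; simp at hq'; omega
  | succ k ih =>
    rintro p q ⟨c, hc⟩ hq hq'
    have hpow : 2 ^ (k + 1) = 2 * 2 ^ k := by ring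
    rw [hpow] at hq'
    rw [hpow, mul_assoc] at hc
    have hlucas := Choose.choose_modEq_choose_mod_mul_choose_div_nat (n := p) (k := q) (p := 2)
    have hmod : Even ((p % 2).choose (q % 2) * (p / 2).choose (q / 2)) := by
      rcases Nat.mod_two_eq_zero_or_one q with h | h
      · exact (ih (p / 2) (q / 2) ⟨c, by omega⟩ (by omega) (by omega)).mul_left _
      · have hp : p % 2 = 0 := by omega
        simp [h, hp]
    rw [Nat.even_iff] at hmod ⊢
    rw [hlucas, hmod]

theorem even_choose_mul_choose {n a b u s m i : ℕ} (hab : b < a)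
    (hn : n = 2 ^ a + 2 ^ b - 1) (hu : u = a - 1 ∨ u = b) (hsm : s + 2 * m + 2 ≤ n - 1)
    (hi : m + 1 + i = 2 ^ u) :
    Even (m.choose i * (s + 1 + m - i).choose (n - 2 * 2 ^ u - s)) := by
  rcases Nat.eq_zero_or_pos i with rfl | hi0
  · refine Even.mul_left ?_ _
    have hbpos : 0 < 2 ^ b := by positivity
    rcases hu with rfl | rfl
    · have hpow : 2 ^ a = 2 * 2 ^ (a - 1) := by
        rw [← pow_succ', Nat.sub_add_cancel (by omega)]
      have hdvd : 2 ^ b ∣ 2 ^ (a - 1) + 2 ^ b :=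
        (pow_dvd_pow 2 (by omega)).add (dvd_refl _)
      refine even_choose_of_two_pow_dvd_add_add_one b _ _ ?_ (by omega) (by omega)
      convert hdvd using 1
      omega
    · have hle : 2 * 2 ^ u ≤ 2 ^ a := by
        rw [← pow_succ']
        exact Nat.pow_le_pow_right (by norm_num) hab
      refine even_choose_of_two_pow_dvd_add_add_one a _ _ ⟨1, by omega⟩ (by omega) (by omega)
  · exact (even_choose_of_two_pow_dvd_add_add_one u m i ⟨1, by omega⟩ hi0 (by omega)).mul_right _

/-- If `n = 2^a + 2^b − 1` with `a > b > 0` and `u = a − 1` or `u = b`, then the monomial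
`x^(2^u)·t^(n−2^(u+1))` does not appear in any `R_n(s, m)` with `(s, m) ∈ V_R`;
equivalently, `C(m, 2^u−1−m)·C(2m+2−2^u+s, n−2^(u+1)−s)` is even for all `(s, m) ∈ V_R`. -/
theorem stmt9 (n a b u : ℕ) (hab : b < a) (hb : 0 < b) (hn : n = 2 ^ a + 2 ^ b - 1)
    (hu : u = a - 1 ∨ u = b) :
    ∀ s m : ℕ, s + 2 * m + 2 ≤ n - 1 →
      MvPolynomial.coeff (Finsupp.single 0 (2 ^ u) + Finsupp.single 1 (n - 2 ^ (u + 1)))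
          (Rpoly n s m) = 0 ∧
      Even (Cz (m : ℤ) (2 ^ u - 1 - m) *
        Cz (2 * m + 2 - 2 ^ u + s : ℤ) ((n : ℤ) - 2 ^ (u + 1) - s)) := by
  intro s m hsm
  constructor
  · rw [Rpoly, coeff_sum]
    refine Finset.sum_eq_zero fun i _ => ?_
    split_ifs
    · rw [coeff_smul]
      by_cases hi : m + 1 + i = 2 ^ u
      · have hexp : 2 * m + 2 * i + 2 = 2 * 2 ^ u := by omega
        have heven := even_choose_mul_choose hab hn hu hsm hi
        rw [hexp, (ZMod.natCast_eq_zero_iff_even).2 heven, zero_smul]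
      · have hcoeff : coeff (Finsupp.single 0 (2 ^ u) + Finsupp.single 1 (n - 2 ^ (u + 1)))
            (X 0 ^ (m + 1 + i) * X 1 ^ (n - (2 * m + 2 * i + 2)) :
              MvPolynomial (Fin 2) (ZMod 2)) = 0 := by
          rw [X_pow_eq_monomial, X_pow_eq_monomial, monomial_mul, coeff_monomial, if_neg]
          intro h
          exact hi (by simpa using DFunLike.congr_fun h 0)
        rw [hcoeff, smul_zero]
    · simp
    · simp
  · unfold Cz
    split_ifs with h₁ h₂
    · obtain ⟨i, hi⟩ : ∃ i : ℕ, (i : ℤ) = 2 ^ u - 1 - m := ⟨_, Int.toNat_of_nonneg h₁.1⟩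
      have hi' : m + 1 + i = 2 ^ u := by zify; omega
      have heven := even_choose_mul_choose hab hn hu hsm hi'
      have hU : (2 : ℤ) ^ u = ((2 ^ u : ℕ) : ℤ) := by push_cast; rfl
      rw [pow_succ', hU] at h₂
      rw [pow_succ', ← hi, hU]
      convert heven using 3 <;> omega
    all_goals simp
end

section
/- Let n be an odd positive integer that is not of the form 2^a + 2^b − 1 for any integers a > b > 0. Then 𝓡₊ equals the ℤ/2-linear span of the monomials x^j·t^{n−2j} for 1 ≤ j ≤ (n−1)/2. -/
open MvPolynomial

/-- With `x = ab` and `t = a + b`, this is `a * b ^ 2 ^ l + a ^ 2 ^ l * b` in characteristic two. -/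
def mixedPow {R : Type*} [CommRing R] (x t : R) : ℕ → R
  | 0 => 0
  | l + 1 => mixedPow x t l * t ^ 2 ^ l + x ^ 2 ^ l * t

/-- With `x = ab` and `t = a + b`, this is `(∑ i < N, a ^ 2 ^ i) * (∑ i < N, b ^ 2 ^ i)` in
characteristic two. -/
def conjSum {R : Type*} [CommRing R] (x t : R) : ℕ → R
  | 0 => 0
  | N + 1 => conjSum x t N ^ 2 + x + ∑ j ∈ Finset.range N, mixedPow x t (j + 1)

section CharTwo

variable {R S : Type*} [CommRing R] [CommRing S]

theorem map_mixedPow (f : R →+* S) (x t : R) (l : ℕ) :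
    f (mixedPow x t l) = mixedPow (f x) (f t) l := by
  induction l with
  | zero => simp [mixedPow]
  | succ l ih => simp [mixedPow, ih]

theorem map_conjSum (f : R →+* S) (x t : R) (N : ℕ) :
    f (conjSum x t N) = conjSum (f x) (f t) N := by
  induction N with
  | zero => simp [conjSum]
  | succ N ih => simp [conjSum, ih, map_mixedPow]

theorem mixedPow_scale (x t z : R) (l : ℕ) :
    mixedPow (x * z ^ 2) (t * z) l = mixedPow x t l * z ^ (2 ^ l + 1) := by
  induction l with
  | zero => simp [mixedPow]
  | succ l ih => simp only [mixedPow, ih]; ring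

variable [CharP R 2]

theorem mixedPow_sq_succ (x t : R) (l : ℕ) :
    mixedPow x t (l + 1) ^ 2 = mixedPow x t l ^ 2 * t ^ 2 ^ (l + 1) + x ^ 2 ^ (l + 1) * t ^ 2 := by
  simp only [mixedPow, CharTwo.add_sq]
  ring

theorem mixedPow_steenrod (x t : R) (l : ℕ) :
    mixedPow (x * (1 + t + x)) (t * (1 + t)) (l + 1) =
      mixedPow x t (l + 1) + mixedPow x t (l + 2) + mixedPow x t l ^ 2
        + mixedPow x t (l + 1) ^ 2 := by
  have h2 : (2 : R) = 0 := CharTwo.two_eq_zero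
  induction l with
  | zero =>
    simp only [mixedPow]
    linear_combination (x * t ^ 2) * h2
  | succ l ih =>
    rw [mixedPow, ih]
    have hx : (x * (1 + t + x)) ^ 2 ^ (l + 1) =
        x ^ 2 ^ (l + 1) * (1 + t ^ 2 ^ (l + 1) + x ^ 2 ^ (l + 1)) := by
      rw [mul_pow, add_pow_char_pow, add_pow_char_pow, one_pow]
    have ht : (t * (1 + t)) ^ 2 ^ (l + 1) = t ^ 2 ^ (l + 1) * (1 + t ^ 2 ^ (l + 1)) := by
      rw [mul_pow, add_pow_char_pow, one_pow]
    have e1 := mixedPow_sq_succ x t l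
    have e2 := mixedPow_sq_succ x t (l + 1)
    have e3 : mixedPow x t (l + 2) = mixedPow x t (l + 1) * t ^ 2 ^ (l + 1)
      + x ^ 2 ^ (l + 1) * t := rfl
    have e4 : mixedPow x t (l + 3) = mixedPow x t (l + 2) * (t ^ 2 ^ (l + 1)) ^ 2
      + (x ^ 2 ^ (l + 1)) ^ 2 * t := by rw [← pow_mul, ← pow_mul]; rfl
    rw [show 2 ^ (l + 1 + 1) = 2 ^ (l + 1) * 2 from pow_succ _ _, pow_mul, pow_mul] at e2
    rw [hx, ht]
    generalize t ^ 2 ^ (l + 1) = u at *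
    generalize x ^ 2 ^ (l + 1) = v at *
    generalize mixedPow x t (l + 1) = p at *
    generalize mixedPow x t (l + 2) = q at *
    generalize mixedPow x t (l + 3) = r at *
    generalize mixedPow x t l = o at *
    grind

theorem conjSum_steenrod (x t : R) (N : ℕ) :
    conjSum (x * (1 + t + x)) (t * (1 + t)) N = x + mixedPow x t N + x ^ 2 ^ N := by
  have h2 : (2 : R) = 0 := CharTwo.two_eq_zero
  have tele (N : ℕ) : ∑ j ∈ Finset.range N, mixedPow (x * (1 + t + x)) (t * (1 + t)) (j + 1) =
      x * t + mixedPow x t (N + 1) + mixedPow x t N ^ 2 := by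
    induction N with
    | zero => simp only [mixedPow, Finset.sum_range_zero]; linear_combination (- x * t) * h2
    | succ N ih =>
      rw [Finset.sum_range_succ, ih, mixedPow_steenrod]
      linear_combination (mixedPow x t (N + 1) + mixedPow x t N ^ 2) * h2
  induction N with
  | zero => simp only [conjSum, mixedPow]; linear_combination (- x) * h2
  | succ N ih =>
    rw [conjSum, ih, tele, CharTwo.add_sq, CharTwo.add_sq]
    ring_nf
    linear_combination (x * t + x ^ 2 + mixedPow x t N ^ 2) * h2

end CharTwo

/-- The total Steenrod square `x ↦ x + xt + x²`, `t ↦ t + t²`, with the weight (`x` of weight two,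
`t` of weight one) recorded by the exponent of the polynomial variable. -/
noncomputable def totalSq :
    MvPolynomial (Fin 2) (ZMod 2) →ₐ[ZMod 2] Polynomial (MvPolynomial (Fin 2) (ZMod 2)) :=
  aeval ![Polynomial.C (X 0) * Polynomial.X ^ 2 *
      (1 + Polynomial.C (X 1) * Polynomial.X + Polynomial.C (X 0) * Polynomial.X ^ 2),
    Polynomial.C (X 1) * Polynomial.X * (1 + Polynomial.C (X 1) * Polynomial.X)]

theorem totalSq_X0 : totalSq (X 0) = Polynomial.C (X 0) * Polynomial.X ^ 2 *
    (1 + Polynomial.C (X 1) * Polynomial.X + Polynomial.C (X 0) * Polynomial.X ^ 2) := by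
  simp [totalSq]

theorem totalSq_X1 : totalSq (X 1) =
    Polynomial.C (X 1) * Polynomial.X * (1 + Polynomial.C (X 1) * Polynomial.X) := by
  simp [totalSq]

/-- The polynomial `x (1 + t)`, with weights recorded by the polynomial variable. -/
noncomputable def twist : Polynomial (MvPolynomial (Fin 2) (ZMod 2)) :=
  Polynomial.C (X 0) * Polynomial.X ^ 2 * (1 + Polynomial.C (X 1) * Polynomial.X)

/-- The weight `n` part of `x (1 + t) Sq(p)`. -/
noncomputable def twistedSq (n : ℕ) :
    MvPolynomial (Fin 2) (ZMod 2) →ₗ[ZMod 2] MvPolynomial (Fin 2) (ZMod 2) :=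
  ((Polynomial.lcoeff (MvPolynomial (Fin 2) (ZMod 2)) n).restrictScalars (ZMod 2)) ∘ₗ
    LinearMap.mulLeft (ZMod 2) twist ∘ₗ totalSq.toLinearMap

theorem twistedSq_apply (n : ℕ) (p : MvPolynomial (Fin 2) (ZMod 2)) :
    twistedSq n p = (twist * totalSq p).coeff n := rfl

theorem twist_mul_totalSq_monomial (s m : ℕ) :
    twist * totalSq (X 0 ^ m * X 1 ^ s) =
      Polynomial.C (X 0 * (X 0 ^ m * X 1 ^ s)) *
        ((1 + Polynomial.C (X 1) * Polynomial.X) ^ (s + 1) *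
        (1 + Polynomial.C (X 1) * Polynomial.X + Polynomial.C (X 0) * Polynomial.X ^ 2) ^ m) *
        Polynomial.X ^ (s + 2 * m + 2) := by
  simp only [twist, map_mul, map_pow, totalSq_X0, totalSq_X1, mul_pow]
  ring

theorem coeff_one_add_C_mul_X_pow {R : Type*} [CommRing R] (r : R) (k d : ℕ) :
    ((1 + Polynomial.C r * Polynomial.X) ^ k).coeff d = (k.choose d : R) * r ^ d := by
  have h : (1 + Polynomial.C r * Polynomial.X) ^ k =
      ((1 + Polynomial.X) ^ k : Polynomial R).comp (Polynomial.C r * Polynomial.X) := by simp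
  rw [h, Polynomial.comp_C_mul_X_coeff, Polynomial.coeff_one_add_X_pow]

theorem twistedSq_monomial (n s m : ℕ) : twistedSq n (X 0 ^ m * X 1 ^ s) = Rpoly n s m := by
  have h : twist * totalSq (X 0 ^ m * X 1 ^ s) = ∑ i ∈ Finset.range (m + 1),
      Polynomial.C ((m.choose i : MvPolynomial (Fin 2) (ZMod 2)) * X 0 ^ (m + 1 + i) * X 1 ^ s) *
        (1 + Polynomial.C (X 1) * Polynomial.X) ^ (s + 1 + m - i) *
        Polynomial.X ^ (2 * m + 2 * i + 2 + s) := by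
    rw [twist_mul_totalSq_monomial, add_comm _ (Polynomial.C (X 0) * Polynomial.X ^ 2),
      add_pow (Polynomial.C (X 0) * _), Finset.mul_sum, Finset.mul_sum, Finset.sum_mul]
    refine Finset.sum_congr rfl fun i hi => ?_
    obtain ⟨k, rfl⟩ := Nat.exists_eq_add_of_le (Nat.lt_succ_iff.mp (Finset.mem_range.mp hi))
    rw [show s + 1 + (i + k) - i = s + 1 + k by omega, Nat.add_sub_cancel_left]
    simp only [map_mul, map_pow, map_natCast]
    ring
  rw [twistedSq_apply, h, Polynomial.finsetSum_coeff, Rpoly]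
  refine Finset.sum_congr rfl fun i _ => ?_
  rw [Polynomial.coeff_mul_X_pow', Polynomial.coeff_C_mul, coeff_one_add_C_mul_X_pow]
  by_cases h1 : 2 * m + 2 * i + 2 + s ≤ n
  · rw [if_pos h1, if_pos (by omega), if_pos (by omega), MvPolynomial.smul_eq_C_mul,
      show n - (2 * m + 2 * i + 2) = (n - (2 * m + 2 * i + 2 + s)) + s by omega,
      Nat.add_sub_cancel]
    simp only [Nat.cast_mul, map_mul, map_natCast]
    ring
  · rw [if_neg h1]
    split_ifs
    · omega
    · simp
    · rfl

theorem twistedSq_mem_Rplus {n s m : ℕ} (hn : 0 < n) (h : s + 2 * m + 2 ≠ n) :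
    twistedSq n (X 0 ^ m * X 1 ^ s) ∈ Rplus n := by
  rcases lt_or_gt_of_ne h with h | h
  · exact twistedSq_monomial n s m ▸ Submodule.subset_span ⟨s, m, by omega, rfl⟩
  · rw [twistedSq_apply, twist_mul_totalSq_monomial, Polynomial.coeff_mul_X_pow', if_neg (by omega)]
    exact zero_mem _

theorem twistedSq_bottom {n s m : ℕ} (h : s + 2 * m + 2 = n) :
    twistedSq n (X 0 ^ m * X 1 ^ s) = X 0 * (X 0 ^ m * X 1 ^ s) := by
  rw [twistedSq_apply, twist_mul_totalSq_monomial, Polynomial.coeff_mul_X_pow', if_pos h.le, h,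
    Nat.sub_self, Polynomial.coeff_C_mul, Polynomial.coeff_zero_eq_eval_zero]
  simp

theorem twistedSq_top (s m : ℕ) : twistedSq (2 * s + 4 * m + 3) (X 0 ^ m * X 1 ^ s) =
    X 0 ^ (2 * m + 1) * X 1 ^ (2 * s + 1) := by
  have ht : (1 + Polynomial.C (X 1 : MvPolynomial (Fin 2) (ZMod 2)) * Polynomial.X).natDegree
      ≤ 1 := by compute_degree
  have hx : (1 + Polynomial.C (X 1 : MvPolynomial (Fin 2) (ZMod 2)) * Polynomial.X
      + Polynomial.C (X 0) * Polynomial.X ^ 2).natDegree ≤ 2 := by compute_degree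
  rw [twistedSq_apply, twist_mul_totalSq_monomial, Polynomial.coeff_mul_X_pow',
    if_pos (by omega), Polynomial.coeff_C_mul,
    show 2 * s + 4 * m + 3 - (s + 2 * m + 2) = (s + 1) * 1 + m * 2 by omega,
    Polynomial.coeff_mul_add_eq_of_natDegree_le
      (Polynomial.natDegree_pow_le_of_le _ ht) (Polynomial.natDegree_pow_le_of_le _ hx),
    Polynomial.coeff_pow_of_natDegree_le ht, Polynomial.coeff_pow_of_natDegree_le hx]
  simp [Polynomial.coeff_one]
  ring

theorem totalSq_conjSum (N : ℕ) : totalSq (conjSum (X 0) (X 1) N) =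
    Polynomial.C (X 0) * Polynomial.X ^ 2
      + Polynomial.C (mixedPow (X 0) (X 1) N) * Polynomial.X ^ (2 ^ N + 1)
      + (Polynomial.C (X 0) * Polynomial.X ^ 2) ^ 2 ^ N := by
  have h := map_conjSum totalSq.toRingHom (X 0) (X 1) N
  simp only [AlgHom.toRingHom_eq_coe, RingHom.coe_coe, totalSq_X0, totalSq_X1] at h
  rw [h, conjSum_steenrod, mixedPow_scale, map_mixedPow]

theorem twistedSq_mul_conjSum (s m : ℕ) :
    twistedSq (2 * s + 4 * m + 5)
        (X 0 ^ m * X 1 ^ s * conjSum (X 0) (X 1) (2 * s + 4 * m + 5)) =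
      X 0 ^ (2 * m + 2) * X 1 ^ (2 * s + 1) := by
  have hlt := Nat.lt_two_pow_self (n := 2 * s + 4 * m + 5)
  rw [twistedSq_apply, map_mul, totalSq_conjSum, ← mul_assoc, mul_add, mul_add, mul_pow,
    ← pow_mul, ← mul_assoc, ← mul_assoc, ← mul_assoc, Polynomial.coeff_add, Polynomial.coeff_add,
    Polynomial.coeff_mul_X_pow', if_pos (by omega), Polynomial.coeff_mul_X_pow',
    if_neg (by omega), Polynomial.coeff_mul_X_pow', if_neg (by omega), Polynomial.coeff_mul_C,
    show 2 * s + 4 * m + 5 - 2 = 2 * s + 4 * m + 3 by omega, ← twistedSq_apply, twistedSq_top]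
  ring

/-- The span of the monomials `x ^ a * t ^ b` whose weight `2 a + b` satisfies `P`. -/
noncomputable def weightSpan (P : ℕ → Prop) : Submodule (ZMod 2) (MvPolynomial (Fin 2) (ZMod 2)) :=
  Submodule.span (ZMod 2) {p | ∃ a b : ℕ, P (2 * a + b) ∧ p = X 0 ^ a * X 1 ^ b}

theorem mul_monomial_mem_weightSpan {P Q : ℕ → Prop} {a b : ℕ}
    (h : ∀ d, P d → Q (d + (2 * a + b))) {p : MvPolynomial (Fin 2) (ZMod 2)}
    (hp : p ∈ weightSpan P) : p * (X 0 ^ a * X 1 ^ b) ∈ weightSpan Q := by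
  induction hp using Submodule.span_induction with
  | mem p hp =>
    obtain ⟨a', b', hP, rfl⟩ := hp
    refine Submodule.subset_span ⟨a' + a, b' + b, ?_, by ring⟩
    convert h _ hP using 1
    ring
  | zero => simp
  | add p q _ _ hp hq => rw [add_mul]; exact add_mem hp hq
  | smul c p _ hp => rw [smul_mul_assoc]; exact Submodule.smul_mem _ _ hp

theorem sq_mem_weightSpan {P : ℕ → Prop} (h : ∀ d, P d → P (2 * d))
    {p : MvPolynomial (Fin 2) (ZMod 2)} (hp : p ∈ weightSpan P) : p ^ 2 ∈ weightSpan P := by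
  induction hp using Submodule.span_induction with
  | mem p hp =>
    obtain ⟨a, b, hP, rfl⟩ := hp
    refine Submodule.subset_span ⟨2 * a, 2 * b, ?_, by ring⟩
    convert h _ hP using 1
    ring
  | zero => simp
  | add p q _ _ hp hq => rw [CharTwo.add_sq]; exact add_mem hp hq
  | smul c p _ hp => rw [smul_pow]; exact Submodule.smul_mem _ _ hp

theorem mixedPow_mem_weightSpan (l : ℕ) :
    mixedPow (X 0) (X 1) l ∈ weightSpan (fun d => d = 2 ^ l + 1) := by
  induction l with
  | zero => exact zero_mem _
  | succ l ih =>
    refine add_mem ?_ (Submodule.subset_span ⟨2 ^ l, 1, by ring, by rw [pow_one]⟩)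
    have := mul_monomial_mem_weightSpan (Q := fun d => d = 2 ^ (l + 1) + 1) (a := 0) (b := 2 ^ l)
      (by rintro d rfl; ring) ih
    simpa using this

theorem conjSum_sub_mem_weightSpan (N : ℕ) :
    conjSum (X 0) (X 1) N - ∑ i ∈ Finset.range N, X 0 ^ 2 ^ i ∈
      weightSpan (fun d => ∃ i j : ℕ, i < j ∧ d = 2 ^ i + 2 ^ j) := by
  induction N with
  | zero => simp [conjSum]
  | succ N ih =>
    have hsq := sq_mem_weightSpan (by
      rintro d ⟨i, j, hij, rfl⟩
      exact ⟨i + 1, j + 1, by omega, by ring⟩) ih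
    rw [CharTwo.sub_eq_add, CharTwo.add_sq, CharTwo.sum_sq] at hsq
    have hw : ∑ j ∈ Finset.range N, mixedPow (X 0) (X 1) (j + 1) ∈
        weightSpan (fun d => ∃ i j : ℕ, i < j ∧ d = 2 ^ i + 2 ^ j) := by
      refine sum_mem fun j _ => Submodule.span_mono ?_ (mixedPow_mem_weightSpan (j + 1))
      rintro _ ⟨a, b, h, rfl⟩
      exact ⟨a, b, ⟨0, j + 1, by omega, by rw [h]; ring⟩, rfl⟩
    convert add_mem hsq hw using 1
    rw [conjSum, Finset.sum_range_succ', CharTwo.sub_eq_add]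
    simp only [← pow_mul, ← pow_succ]
    linear_combination X 0 * (CharTwo.two_eq_zero (R := MvPolynomial (Fin 2) (ZMod 2)))

theorem twistedSq_mul_mem_Rplus {n s m : ℕ} (hn : 0 < n) {P : ℕ → Prop}
    (hP : ∀ d, P d → d + (2 * m + s) + 2 ≠ n) {p : MvPolynomial (Fin 2) (ZMod 2)}
    (hp : p ∈ weightSpan P) : twistedSq n (p * (X 0 ^ m * X 1 ^ s)) ∈ Rplus n := by
  have h := mul_monomial_mem_weightSpan (Q := fun d => d + 2 ≠ n) hP hp
  generalize p * (X 0 ^ m * X 1 ^ s) = q at h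
  induction h using Submodule.span_induction with
  | mem q hq =>
    obtain ⟨a, b, h, rfl⟩ := hq
    exact twistedSq_mem_Rplus hn (by omega)
  | zero => simp
  | add p q _ _ hp hq => rw [map_add]; exact add_mem hp hq
  | smul c p _ hp => rw [map_smul]; exact Submodule.smul_mem _ _ hp

theorem monomial_mem_Rplus {g : ℕ}
    (hg : ∀ i j : ℕ, i < j → 2 ^ i + 2 ^ j ≠ g + 1) (c b : ℕ) (hcb : c + 1 + b = g) :
    X 0 ^ (b + 1) * X 1 ^ (2 * c + 1) ∈ Rplus (2 * g + 1) := by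
  induction c using Nat.strong_induction_on generalizing b with
  | _ c ih =>
  obtain ⟨k, rfl | rfl⟩ := b.even_or_odd'
  · rw [← twistedSq_top, show 2 * c + 4 * k + 3 = 2 * g + 1 by omega]
    exact twistedSq_mem_Rplus (by omega) (by omega)
  · have hn : 2 * c + 4 * k + 5 = 2 * g + 1 := by omega
    have hp := conjSum_sub_mem_weightSpan (2 * g + 1)
    obtain ⟨p, hY⟩ : ∃ p, conjSum (X 0) (X 1) (2 * g + 1) -
      ∑ i ∈ Finset.range (2 * g + 1), (X 0 : MvPolynomial (Fin 2) (ZMod 2)) ^ 2 ^ i = p := ⟨_, rfl⟩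
    rw [hY] at hp
    rw [add_assoc, one_add_one_eq_two, ← twistedSq_mul_conjSum, hn, sub_eq_iff_eq_add.mp hY,
      mul_add, map_add]
    refine add_mem ?_ ?_
    · rw [mul_comm _ p]
      refine twistedSq_mul_mem_Rplus (by omega) ?_ hp
      rintro d ⟨i, j, hij, rfl⟩
      have := hg i j hij
      omega
    · rw [Finset.mul_sum, map_sum]
      refine sum_mem fun i _ => ?_
      rw [show (X 0 ^ k * X 1 ^ c * X 0 ^ 2 ^ i : MvPolynomial (Fin 2) (ZMod 2)) =
        X 0 ^ (k + 2 ^ i) * X 1 ^ c by ring]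
      by_cases h : c + 2 * (k + 2 ^ i) + 2 = 2 * g + 1
      · rw [twistedSq_bottom h, ← mul_assoc, ← pow_succ']
        obtain ⟨c', rfl | rfl⟩ := c.even_or_odd'
        · omega
        · exact ih c' (by omega) _ (by omega)
      · exact twistedSq_mem_Rplus (by omega) h

/-- Let `n` be an odd positive integer not of the form `2^a + 2^b − 1` with `a > b > 0`.
Then `𝓡₊` equals the `ℤ/2`-linear span of the monomials `x^j·t^(n−2j)`, `1 ≤ j ≤ (n−1)/2`. -/
theorem stmt10 (n : ℕ) (hn : Odd n) (hpos : 0 < n)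
    (hform : ¬ ∃ a b : ℕ, b < a ∧ 0 < b ∧ n = 2 ^ a + 2 ^ b - 1) :
    Rplus n =
      Submodule.span (ZMod 2)
        {q : MvPolynomial (Fin 2) (ZMod 2) |
          ∃ j : ℕ, 1 ≤ j ∧ j ≤ (n - 1) / 2 ∧ q = X 0 ^ j * X 1 ^ (n - 2 * j)} := by
  obtain ⟨g, rfl⟩ := hn
  apply le_antisymm <;> refine Submodule.span_le.mpr ?_
  · rintro _ ⟨s, m, -, rfl⟩
    refine sum_mem fun i _ => ?_
    split_ifs with h
    · exact Submodule.smul_mem _ _ (Submodule.subset_span ⟨m + 1 + i, by omega, by omega, by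
        congr 2; omega⟩)
    · rw [zero_smul]
      exact zero_mem _
    · exact zero_mem _
  · rintro _ ⟨j, h1, h2, rfl⟩
    have hg (i j : ℕ) (hij : i < j) : 2 ^ i + 2 ^ j ≠ g + 1 := fun h =>
      hform ⟨j + 1, i + 1, by omega, by omega, by rw [pow_succ, pow_succ]; omega⟩
    obtain ⟨b, rfl⟩ := Nat.exists_eq_add_of_le' h1
    have hb : b + 1 ≤ g := by omega
    rw [SetLike.mem_coe, show 2 * g + 1 - 2 * (b + 1) = 2 * (g - 1 - b) + 1 by omega]
    exact monomial_mem_Rplus hg (g - 1 - b) b (by omega)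
end

section
/- Let n = 2^a with a ≥ 2. Then the ℤ/2-linear span of {R_n(s,m) : (s,m) ∈ V_R} ∪ {R₀} equals the ℤ/2-linear span of the monomials x^j·t^{n−2j} for 2 ≤ j ≤ n/2 − 1 together with the element x·t^{n−2} + x^{n/2}. In particular this span has codimension 1 in the span of all monomials x^j·t^{n−2j}, 1 ≤ j ≤ n/2. -/
open MvPolynomial

/-- The monomial `x^j·t^(n−2j)`. -/
noncomputable abbrev weightMonomial (n j : ℕ) : MvPolynomial (Fin 2) (ZMod 2) :=
  X 0 ^ j * X 1 ^ (n - 2 * j)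

theorem choose_mod_two_eq (p q : ℕ) :
    p.choose q % 2 = ((p % 2).choose (q % 2) * (p / 2).choose (q / 2)) % 2 :=
  haveI : Fact (Nat.Prime 2) := ⟨Nat.prime_two⟩
  Choose.choose_modEq_choose_mod_mul_choose_div_nat

theorem choose_even_of_add_add_one_eq_two_pow (a : ℕ) :
    ∀ p q : ℕ, p + q + 1 = 2 ^ a → 1 ≤ q → p.choose q % 2 = 0 := by
  induction a with
  | zero => intro p q h hq; rw [pow_zero] at h; omega
  | succ a ih =>
    intro p q h hq
    rw [pow_succ] at h
    rw [choose_mod_two_eq]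
    rcases Nat.mod_two_eq_zero_or_one q with h0 | h1
    · rw [Nat.mul_mod, ih (p / 2) (q / 2) (by omega) (by omega)]; simp
    · rw [h1, show p % 2 = 0 by omega]; simp

theorem choose_two_pow_odd (k : ℕ) :
    ∀ p d : ℕ, p + 1 = 2 ^ k * (d + 1) → d % 2 = 1 → p.choose (2 ^ k) % 2 = 1 := by
  induction k with
  | zero =>
    intro p d h hd
    rw [pow_zero, Nat.choose_one_right]; rw [pow_zero] at h; omega
  | succ k ih =>
    intro p d h hd
    rw [pow_succ, mul_right_comm] at h
    rw [choose_mod_two_eq, pow_succ, Nat.mul_mod_left, Nat.mul_div_cancel _ two_pos,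
      Nat.choose_zero_right, one_mul]
    exact ih (p / 2) d (by omega) hd

/-- A pivot index for the leading term `x^j·t^(n−2j)` of some `R_n(s, j − 1)`. -/
theorem exists_choose_odd {a j : ℕ} (hj : 2 ≤ j) (hj' : j ≤ 2 ^ a / 2 - 1) :
    ∃ s, s + 2 * j + 1 ≤ 2 ^ a ∧ (s + j).choose (2 ^ a - 2 * j - s) % 2 = 1 := by
  obtain ⟨k, c, hc, hk⟩ := Nat.exists_eq_two_pow_mul_odd (show j - 1 ≠ 0 by omega)
  obtain ⟨c, rfl⟩ := hc
  have hka : k + 1 < a := by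
    have h1 : 2 ^ k ≤ j - 1 := by rw [hk]; exact Nat.le_mul_of_pos_right _ (by omega)
    have h2 : 2 ^ (k + 1) < 2 ^ a := by rw [pow_succ]; omega
    exact (Nat.pow_lt_pow_iff_right (by norm_num)).1 h2
  obtain ⟨b, rfl⟩ := Nat.exists_eq_add_of_lt hka
  have ha : 2 ^ (k + 1 + b + 1) = 2 ^ k * (4 * 2 ^ b) := by ring
  rw [ha] at hj' ⊢
  have hq : 0 < 2 ^ k := by positivity
  have hhalf : 2 ^ k * (4 * 2 ^ b) / 2 = 2 ^ k * (2 * 2 ^ b) := by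
    rw [show 2 ^ k * (4 * 2 ^ b) = 2 ^ k * (2 * 2 ^ b) * 2 by ring]
    exact Nat.mul_div_cancel _ two_pos
  rw [hhalf] at hj'
  have hlt : 2 * c + 1 < 2 * 2 ^ b := by
    refine Nat.lt_of_mul_lt_mul_left (a := 2 ^ k) ?_
    omega
  obtain ⟨e, he⟩ := Nat.exists_eq_add_of_lt hlt
  have hj1 : j = 2 ^ k * (2 * c + 1) + 1 := by omega
  have hn : 2 ^ k * (4 * 2 ^ b) = 2 * (2 ^ k * (2 * c + 1)) + 2 * (2 ^ k * e) + 2 * 2 ^ k := by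
    rw [show 4 * 2 ^ b = 2 * (2 * 2 ^ b) by ring, he]; ring
  have hhn : 2 ^ k * (2 * 2 ^ b) = 2 ^ k * (2 * c + 1) + 2 ^ k * e + 2 ^ k := by rw [he]; ring
  refine ⟨2 ^ k * (4 * 2 ^ b) - 2 * j - 2 ^ k, by omega, ?_⟩
  have hle : 2 ^ k ≤ 2 ^ k * (4 * 2 ^ b) - 2 * j := by
    rcases Nat.eq_zero_or_pos e with rfl | hpos
    · omega
    · have := Nat.le_mul_of_pos_right (2 ^ k) hpos
      omega
  rw [Nat.sub_sub_self hle]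
  refine choose_two_pow_odd k _ (2 * (c + e) + 1) ?_ (by omega)
  rw [show 2 ^ k * (2 * (c + e) + 1 + 1) = 2 ^ k * (2 * c + 1) + 2 * (2 ^ k * e) + 2 ^ k by ring]
  omega

/-- The coefficient of `x^(m+1+i)·t^(n−2m−2i−2)` in `R_n(s, m)`. -/
def RpolyCoeff (n s m i : ℕ) : ZMod 2 :=
  if s + 2 * (m + 1 + i) ≤ n then
    ((m.choose i * (s + 1 + m - i).choose (n - 2 * (m + 1 + i) - s) : ℕ) : ZMod 2)
  else 0

theorem Rpoly_eq_sum (n s m : ℕ) :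
    Rpoly n s m =
      ∑ i ∈ Finset.range (m + 1), RpolyCoeff n s m i • weightMonomial n (m + 1 + i) := by
  refine Finset.sum_congr rfl fun i _ => ?_
  have h : 2 * m + 2 * i + 2 = 2 * (m + 1 + i) := by ring
  rw [h, RpolyCoeff]
  by_cases h1 : s + 2 * (m + 1 + i) ≤ n
  · rw [if_pos (by omega), if_pos (by omega), if_pos h1]
  · rw [if_neg h1, zero_smul]
    by_cases h2 : 2 * (m + 1 + i) ≤ n
    · rw [if_pos h2, if_neg (by omega), zero_smul]
    · rw [if_neg h2]

theorem RpolyCoeff_eq_zero {a s m i : ℕ} (hi : i ≤ m) (hV : s + 2 * m + 2 ≤ 2 ^ a - 1)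
    (hj : ¬(2 ≤ m + 1 + i ∧ m + 1 + i ≤ 2 ^ a / 2 - 1)) : RpolyCoeff (2 ^ a) s m i = 0 := by
  rw [RpolyCoeff]
  split_ifs with h
  · rw [ZMod.natCast_eq_zero_iff, Nat.dvd_iff_mod_eq_zero]
    obtain ⟨b, rfl⟩ : ∃ b, a = b + 1 := by
      cases a with
      | zero => rw [pow_zero] at h; omega
      | succ b => exact ⟨b, rfl⟩
    have hpow : 2 ^ (b + 1) = 2 ^ b * 2 := pow_succ 2 b
    rw [Nat.mul_mod]
    by_cases h1 : m + 1 + i = 1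
    · rw [choose_even_of_add_add_one_eq_two_pow (b + 1) (s + 1 + m - i) _ (by omega) (by omega)]
      simp
    · rw [choose_even_of_add_add_one_eq_two_pow b m i (by omega) (by omega)]
      simp
  · rfl

theorem Rpoly_mem_span {a s m : ℕ} (hV : s + 2 * m + 2 ≤ 2 ^ a - 1) :
    Rpoly (2 ^ a) s m ∈ Submodule.span (ZMod 2)
      {q | ∃ j : ℕ, 2 ≤ j ∧ j ≤ 2 ^ a / 2 - 1 ∧ q = weightMonomial (2 ^ a) j} := by
  rw [Rpoly_eq_sum]
  refine Submodule.sum_mem _ fun i hi => ?_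
  rw [Finset.mem_range] at hi
  by_cases hj : 2 ≤ m + 1 + i ∧ m + 1 + i ≤ 2 ^ a / 2 - 1
  · exact Submodule.smul_mem _ _ (Submodule.subset_span ⟨_, hj.1, hj.2, rfl⟩)
  · rw [RpolyCoeff_eq_zero (by omega) hV hj, zero_smul]
    exact Submodule.zero_mem _

theorem weightMonomial_mem_Rplus (a d : ℕ) :
    ∀ j : ℕ, 2 ≤ j → j ≤ 2 ^ a / 2 - 1 → 2 ^ a / 2 - 1 - j = d →
      weightMonomial (2 ^ a) j ∈ Rplus (2 ^ a) := by
  induction d using Nat.strong_induction_on with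
  | _ d ih =>
    intro j hj hj' hd
    obtain ⟨s, hs, hodd⟩ := exists_choose_odd hj hj'
    obtain ⟨m, rfl⟩ : ∃ m, j = m + 1 := ⟨j - 1, by omega⟩
    have hV : s + 2 * m + 2 ≤ 2 ^ a - 1 := by omega
    have hR : Rpoly (2 ^ a) s m ∈ Rplus (2 ^ a) := Submodule.subset_span ⟨s, m, hV, rfl⟩
    have h0 : RpolyCoeff (2 ^ a) s m 0 = 1 := by
      rw [RpolyCoeff, if_pos (by omega), Nat.choose_zero_right, one_mul, Nat.sub_zero, add_zero,
        add_right_comm, add_assoc, ← ZMod.natCast_mod, hodd, Nat.cast_one]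
    rw [Rpoly_eq_sum, Finset.sum_range_succ', h0, one_smul] at hR
    refine (Submodule.add_mem_iff_right _ (Submodule.sum_mem _ fun i hi => ?_)).1 hR
    rw [Finset.mem_range] at hi
    by_cases hi' : 2 ≤ m + 1 + (i + 1) ∧ m + 1 + (i + 1) ≤ 2 ^ a / 2 - 1
    · exact Submodule.smul_mem _ _ (ih _ (by omega) _ hi'.1 hi'.2 rfl)
    · rw [RpolyCoeff_eq_zero (by omega) hV hi', zero_smul]
      exact Submodule.zero_mem _

theorem Rplus_eq_span (a : ℕ) :
    Rplus (2 ^ a) = Submodule.span (ZMod 2)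
      {q | ∃ j : ℕ, 2 ≤ j ∧ j ≤ 2 ^ a / 2 - 1 ∧ q = weightMonomial (2 ^ a) j} := by
  refine le_antisymm (Submodule.span_le.2 ?_) (Submodule.span_le.2 ?_)
  · rintro _ ⟨s, m, hV, rfl⟩
    exact Rpoly_mem_span hV
  · rintro _ ⟨j, hj, hj', rfl⟩
    exact weightMonomial_mem_Rplus a _ j hj hj' rfl

theorem Rzero_sub_mem_span {n : ℕ} (hn : 4 ≤ n) (he : Even n) :
    Rzero n - (X 0 * X 1 ^ (n - 2) + X 0 ^ (n / 2)) ∈ Submodule.span (ZMod 2)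
      {q | ∃ j : ℕ, 2 ≤ j ∧ j ≤ n / 2 - 1 ∧ q = weightMonomial n j} := by
  obtain ⟨l, rfl⟩ : ∃ l, n = 2 * (l + 2) := by
    obtain ⟨r, rfl⟩ := he
    exact ⟨r - 2, by omega⟩
  have hl : 2 * (l + 2) / 2 = l + 1 + 1 := by omega
  rw [Rzero, hl, Finset.sum_Icc_succ_top (by omega), ← Finset.add_sum_Ioc_eq_sum_Icc (by omega)]
  have h1 : 2 * (l + 2) - 1 - 1 = 2 * (l + 2) - 2 * 1 := by omega
  have h2 : 2 * (l + 2) - 2 * (l + 1 + 1) = 0 := by omega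
  rw [h1, h2, Nat.choose_self, Nat.choose_zero_right, Nat.cast_one, one_smul, one_smul, pow_zero,
    mul_one, pow_one, mul_one, add_right_comm (X 0 * _),
    add_sub_cancel_left (_ + _)]
  refine Submodule.sum_mem _ fun j hj => ?_
  rw [Finset.mem_Ioc] at hj
  exact Submodule.smul_mem _ _ (Submodule.subset_span ⟨j, by omega, by omega, rfl⟩)

theorem coeff_weightMonomial (n j k l : ℕ) :
    coeff (Finsupp.single 0 k + Finsupp.single 1 l) (weightMonomial n j) =
      if j = k ∧ n - 2 * j = l then 1 else 0 := by
  have h : weightMonomial n j =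
      monomial (Finsupp.single 0 j + Finsupp.single 1 (n - 2 * j)) 1 := by
    rw [weightMonomial, X_pow_eq_monomial, X_pow_eq_monomial, monomial_mul, one_mul]
  rw [h, coeff_monomial]
  refine if_congr ⟨fun e => ?_, ?_⟩ rfl rfl
  · exact ⟨by simpa using DFunLike.congr_fun e 0, by simpa using DFunLike.congr_fun e 1⟩
  · rintro ⟨rfl, rfl⟩; rfl

theorem notMem_span_weightMonomial {n : ℕ} (hn : 4 ≤ n) (he : Even n) :
    X 0 * X 1 ^ (n - 2) ∉ Submodule.span (ZMod 2)
      ({q | ∃ j : ℕ, 2 ≤ j ∧ j ≤ n / 2 - 1 ∧ q = weightMonomial n j} ∪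
        {X 0 * X 1 ^ (n - 2) + X 0 ^ (n / 2)}) := by
  have e1 : X 0 * X 1 ^ (n - 2) = weightMonomial n 1 := by rw [weightMonomial, pow_one, mul_one]
  have e2 : X 0 ^ (n / 2) = weightMonomial n (n / 2) := by
    rw [weightMonomial, Nat.mul_div_cancel' he.two_dvd, Nat.sub_self, pow_zero, mul_one]
  rw [e1, e2]
  let φ : MvPolynomial (Fin 2) (ZMod 2) →ₗ[ZMod 2] ZMod 2 :=
    lcoeff (ZMod 2) (Finsupp.single 0 1 + Finsupp.single 1 (n - 2)) -
      lcoeff (ZMod 2) (Finsupp.single 0 (n / 2) + Finsupp.single 1 0)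
  have hφ (j : ℕ) : φ (weightMonomial n j) =
      (if j = 1 ∧ n - 2 * j = n - 2 then 1 else 0) -
        if j = n / 2 ∧ n - 2 * j = 0 then 1 else 0 := by
    rw [← coeff_weightMonomial, ← coeff_weightMonomial]; rfl
  have hn2 := Nat.mul_div_cancel' he.two_dvd
  have h1 : φ (weightMonomial n 1) = 1 := by
    rw [hφ, if_pos (by omega), if_neg (by omega), sub_zero]
  have h2 : φ (weightMonomial n (n / 2)) = -1 := by
    rw [hφ, if_neg (by omega), if_pos (by omega), zero_sub]
  have hle : Submodule.span (ZMod 2)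
      ({q | ∃ j : ℕ, 2 ≤ j ∧ j ≤ n / 2 - 1 ∧ q = weightMonomial n j} ∪
        {weightMonomial n 1 + weightMonomial n (n / 2)}) ≤ LinearMap.ker φ := by
    refine Submodule.span_le.2 ?_
    rintro _ (⟨j, hj, hj', rfl⟩ | rfl)
    · rw [SetLike.mem_coe, LinearMap.mem_ker, hφ, if_neg (by omega), if_neg (by omega), sub_zero]
    · rw [SetLike.mem_coe, LinearMap.mem_ker, map_add, h1, h2, add_neg_cancel]
  intro hmem
  have := LinearMap.mem_ker.1 (hle hmem)
  rw [h1] at this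
  exact one_ne_zero this

theorem span_weightMonomial_sup {n : ℕ} (hn : 4 ≤ n) (he : Even n) :
    Submodule.span (ZMod 2)
        ({q | ∃ j : ℕ, 2 ≤ j ∧ j ≤ n / 2 - 1 ∧ q = weightMonomial n j} ∪
          {X 0 * X 1 ^ (n - 2) + X 0 ^ (n / 2)}) ⊔
      Submodule.span (ZMod 2) {X 0 * X 1 ^ (n - 2)} =
      Submodule.span (ZMod 2) {q | ∃ j : ℕ, 1 ≤ j ∧ j ≤ n / 2 ∧ q = weightMonomial n j} := by
  have e1 : X 0 * X 1 ^ (n - 2) = weightMonomial n 1 := by rw [weightMonomial, pow_one, mul_one]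
  have e2 : X 0 ^ (n / 2) = weightMonomial n (n / 2) := by
    rw [weightMonomial, Nat.mul_div_cancel' he.two_dvd, Nat.sub_self, pow_zero, mul_one]
  rw [e1, e2, ← Submodule.span_union]
  have hmem {j : ℕ} (h1 : 1 ≤ j) (h2 : j ≤ n / 2) : weightMonomial n j ∈
      Submodule.span (ZMod 2) {q | ∃ j : ℕ, 1 ≤ j ∧ j ≤ n / 2 ∧ q = weightMonomial n j} :=
    Submodule.subset_span ⟨j, h1, h2, rfl⟩
  refine le_antisymm (Submodule.span_le.2 ?_) (Submodule.span_le.2 ?_)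
  · rintro _ ((⟨j, hj, hj', rfl⟩ | rfl) | rfl)
    · exact hmem (by omega) (by omega)
    · exact Submodule.add_mem _ (hmem le_rfl (by omega)) (hmem (by omega) le_rfl)
    · exact hmem le_rfl (by omega)
  · rintro _ ⟨j, hj, hj', rfl⟩
    by_cases h1 : j = 1
    · subst h1
      exact Submodule.subset_span (Or.inr rfl)
    by_cases h2 : j = n / 2
    · subst h2
      rw [SetLike.mem_coe]
      refine (Submodule.add_mem_iff_right _ (x := weightMonomial n 1) ?_).1 ?_
      · exact Submodule.subset_span (Or.inr rfl)
      · exact Submodule.subset_span (Or.inl (Or.inr rfl))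
    · exact Submodule.subset_span (Or.inl (Or.inl ⟨j, by omega, by omega, rfl⟩))

/-- Let `n = 2^a` with `a ≥ 2`.  Then the `ℤ/2`-linear span `𝓡` of
`{R_n(s,m) : (s,m) ∈ V_R} ∪ {R₀}` equals the span of the monomials `x^j·t^(n−2j)`,
`2 ≤ j ≤ n/2 − 1`, together with the element `x·t^(n−2) + x^(n/2)`.  In particular `𝓡` has
codimension `1` in the span of all the monomials `x^j·t^(n−2j)`, `1 ≤ j ≤ n/2`. -/
theorem stmt13 (n a : ℕ) (ha : 2 ≤ a) (hn : n = 2 ^ a) :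
    Submodule.span (ZMod 2)
        ({p : MvPolynomial (Fin 2) (ZMod 2) |
            ∃ s m : ℕ, s + 2 * m + 2 ≤ n - 1 ∧ p = Rpoly n s m} ∪ {Rzero n}) =
      Submodule.span (ZMod 2)
        ({q : MvPolynomial (Fin 2) (ZMod 2) |
            ∃ j : ℕ, 2 ≤ j ∧ j ≤ n / 2 - 1 ∧ q = X 0 ^ j * X 1 ^ (n - 2 * j)} ∪
          {X 0 * X 1 ^ (n - 2) + X 0 ^ (n / 2)}) ∧
    X 0 * X 1 ^ (n - 2) ∉
      Submodule.span (ZMod 2)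
        ({p : MvPolynomial (Fin 2) (ZMod 2) |
            ∃ s m : ℕ, s + 2 * m + 2 ≤ n - 1 ∧ p = Rpoly n s m} ∪ {Rzero n}) ∧
    Submodule.span (ZMod 2)
        ({p : MvPolynomial (Fin 2) (ZMod 2) |
            ∃ s m : ℕ, s + 2 * m + 2 ≤ n - 1 ∧ p = Rpoly n s m} ∪ {Rzero n}) ⊔
      Submodule.span (ZMod 2) {(X 0 * X 1 ^ (n - 2) : MvPolynomial (Fin 2) (ZMod 2))} =
      Submodule.span (ZMod 2)
        {q : MvPolynomial (Fin 2) (ZMod 2) |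
          ∃ j : ℕ, 1 ≤ j ∧ j ≤ n / 2 ∧ q = X 0 ^ j * X 1 ^ (n - 2 * j)} := by
  have h4 : 4 ≤ n := hn ▸ Nat.pow_le_pow_right two_pos ha
  have he : Even n := hn ▸ (Nat.even_pow.2 ⟨even_two, by omega⟩)
  have hspan : Submodule.span (ZMod 2)
        ({p : MvPolynomial (Fin 2) (ZMod 2) |
            ∃ s m : ℕ, s + 2 * m + 2 ≤ n - 1 ∧ p = Rpoly n s m} ∪ {Rzero n}) =
      Submodule.span (ZMod 2)
        ({q : MvPolynomial (Fin 2) (ZMod 2) |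
            ∃ j : ℕ, 2 ≤ j ∧ j ≤ n / 2 - 1 ∧ q = X 0 ^ j * X 1 ^ (n - 2 * j)} ∪
          {X 0 * X 1 ^ (n - 2) + X 0 ^ (n / 2)}) := by
    have hR := Rzero_sub_mem_span h4 he
    have hplus := Rplus_eq_span a
    rw [← hn, Rplus] at hplus
    rw [Submodule.span_union, Submodule.span_union, hplus]
    refine le_antisymm (sup_le le_sup_left ?_) (sup_le le_sup_left ?_) <;>
      rw [Submodule.span_singleton_le_iff_mem]
    · rw [← sub_add_cancel (Rzero n) (X 0 * X 1 ^ (n - 2) + X 0 ^ (n / 2))]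
      exact Submodule.add_mem_sup hR (Submodule.mem_span_singleton_self _)
    · rw [← sub_sub_cancel (Rzero n) (X 0 * X 1 ^ (n - 2) + X 0 ^ (n / 2))]
      exact Submodule.sub_mem _ (Submodule.mem_sup_right (Submodule.mem_span_singleton_self _))
        (Submodule.mem_sup_left hR)
  rw [hspan]
  exact ⟨rfl, notMem_span_weightMonomial h4 he, span_weightMonomial_sup h4 he⟩
end

section
/- For every odd positive integer n, the element R₀ lies in 𝓡₊. -/
open MvPolynomial

/-- If `d = 1 + a d²` and `g = d + b g²` with `a` and `b` divisible by `z`, then `g` is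
`z`-adically approximated by polynomials in `a` and `b`. -/
theorem exists_mem_adjoin_pow_dvd_sub (K : Type*) {R : Type*} [CommRing K] [CommRing R]
    [Algebra K R] {a b d g z : R} (ha : z ∣ a) (hb : z ∣ b) (hd : d = 1 + a * d ^ 2)
    (hg : g = d + b * g ^ 2) (N : ℕ) :
    ∃ p ∈ Algebra.adjoin K {a, b}, z ^ N ∣ g - p := by
  have hamem : a ∈ Algebra.adjoin K {a, b} := Algebra.subset_adjoin (by simp)
  have hbmem : b ∈ Algebra.adjoin K {a, b} := Algebra.subset_adjoin (by simp)
  obtain ⟨a', rfl⟩ := ha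
  obtain ⟨b', rfl⟩ := hb
  have approx_d : ∀ N, ∃ p ∈ Algebra.adjoin K {z * a', z * b'}, z ^ N ∣ d - p := by
    intro N
    induction N with
    | zero => exact ⟨0, zero_mem _, by simp⟩
    | succ N ih =>
      obtain ⟨p, hp, c, hc⟩ := ih
      refine ⟨1 + z * a' * p ^ 2, add_mem (one_mem _) (mul_mem hamem (pow_mem hp 2)),
        a' * c * (d + p), ?_⟩
      linear_combination hd + z * a' * (d + p) * hc
  induction N with
  | zero => exact ⟨0, zero_mem _, by simp⟩
  | succ N ih =>
    obtain ⟨p, hp, c, hc⟩ := ih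
    obtain ⟨q, hq, e, he⟩ := approx_d (N + 1)
    refine ⟨q + z * b' * p ^ 2, add_mem hq (mul_mem hbmem (pow_mem hp 2)),
      e + b' * c * (g + p), ?_⟩
    linear_combination hg + he + z * b' * (g + p) * hc

/-- The series `t z` over `(ℤ/2)[x, t]`; the power of `z` records the weight, where `t` has
weight `1` and `x` has weight `2`. -/
noncomputable def tSeries : PowerSeries (MvPolynomial (Fin 2) (ZMod 2)) :=
  PowerSeries.C (X 1) * PowerSeries.X

/-- The series `x z²` over `(ℤ/2)[x, t]`. -/
noncomputable def xSeries : PowerSeries (MvPolynomial (Fin 2) (ZMod 2)) :=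
  PowerSeries.C (X 0) * PowerSeries.X ^ 2

/-- The inverse of `1 + t z`. -/
noncomputable def invOneAddT : PowerSeries (MvPolynomial (Fin 2) (ZMod 2)) :=
  PowerSeries.rescale (X 1) (PowerSeries.mk 1)

theorem powerSeries_two_eq_zero :
    (2 : PowerSeries (MvPolynomial (Fin 2) (ZMod 2))) = 0 := by
  have h : (2 : MvPolynomial (Fin 2) (ZMod 2)) = 0 := CharTwo.two_eq_zero
  rw [← map_ofNat PowerSeries.C 2, h, map_zero]

theorem one_add_tSeries_eq_rescale :
    1 + tSeries = PowerSeries.rescale (X 1) (1 + PowerSeries.X) := by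
  rw [map_add, map_one, PowerSeries.rescale_X, tSeries]

theorem one_add_tSeries_mul_invOneAddT : (1 + tSeries) * invOneAddT = 1 := by
  have h := congrArg (PowerSeries.rescale (X 1 : MvPolynomial (Fin 2) (ZMod 2)))
    (PowerSeries.mk_one_mul_one_sub_eq_one (MvPolynomial (Fin 2) (ZMod 2)))
  rw [map_mul, map_sub, map_one, PowerSeries.rescale_X, ← tSeries, ← invOneAddT] at h
  linear_combination h + tSeries * invOneAddT * powerSeries_two_eq_zero

theorem isUnit_one_add_tSeries_add_xSeries : IsUnit (1 + tSeries + xSeries) := by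
  rw [PowerSeries.isUnit_iff_constantCoeff]
  simp [tSeries, xSeries]

theorem coeff_one_add_tSeries_pow (a k : ℕ) :
    PowerSeries.coeff k ((1 + tSeries) ^ a) =
      X 1 ^ k * ((a.choose k : ℕ) : MvPolynomial (Fin 2) (ZMod 2)) := by
  rw [one_add_tSeries_eq_rescale, ← map_pow, PowerSeries.coeff_rescale]
  congr 1
  rw [← Polynomial.coeff_one_add_X_pow, ← Polynomial.coeff_coe]
  simp

theorem coeff_invOneAddT_pow_succ (j k : ℕ) :
    PowerSeries.coeff k (invOneAddT ^ (j + 1)) =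
      X 1 ^ k * (((j + k).choose j : ℕ) : MvPolynomial (Fin 2) (ZMod 2)) := by
  rw [invOneAddT, ← map_pow, PowerSeries.mk_one_pow_eq_mk_choose_add,
    PowerSeries.coeff_rescale, PowerSeries.coeff_mk]

theorem coeff_xSeries_pow_mul (n j : ℕ) (f : PowerSeries (MvPolynomial (Fin 2) (ZMod 2))) :
    PowerSeries.coeff n (xSeries ^ j * f) =
      if 2 * j ≤ n then X 0 ^ j * PowerSeries.coeff (n - 2 * j) f else 0 := by
  rw [xSeries, mul_pow, ← map_pow, ← pow_mul, mul_assoc, PowerSeries.coeff_C_mul,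
    PowerSeries.coeff_X_pow_mul', mul_ite, mul_zero]

theorem coeff_tSeries_pow_mul (n s : ℕ) (f : PowerSeries (MvPolynomial (Fin 2) (ZMod 2))) :
    PowerSeries.coeff n (tSeries ^ s * f) =
      if s ≤ n then X 1 ^ s * PowerSeries.coeff (n - s) f else 0 := by
  rw [tSeries, mul_pow, ← map_pow, mul_assoc, PowerSeries.coeff_C_mul,
    PowerSeries.coeff_X_pow_mul', mul_ite, mul_zero]

/-- `R_n(s, m)` is the weight `n` part of `x (1 + t) (t (1 + t))^s (x (1 + t + x))^m`. -/
theorem Rpoly_eq_coeff (n s m : ℕ) :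
    Rpoly n s m = PowerSeries.coeff n (xSeries * (1 + tSeries) *
      ((tSeries * (1 + tSeries)) ^ s * (xSeries * (1 + tSeries + xSeries)) ^ m)) := by
  have expand : xSeries * (1 + tSeries) *
      ((tSeries * (1 + tSeries)) ^ s * (xSeries * (1 + tSeries + xSeries)) ^ m) =
      ∑ i ∈ Finset.range (m + 1), m.choose i •
        (xSeries ^ (m + 1 + i) * (tSeries ^ s * (1 + tSeries) ^ (s + 1 + m - i))) := by
    rw [add_comm (1 + tSeries) xSeries, mul_pow xSeries, add_pow, mul_pow, Finset.mul_sum,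
      Finset.mul_sum, Finset.mul_sum]
    refine Finset.sum_congr rfl fun i hi => ?_
    have hi : i ≤ m := Nat.lt_succ_iff.mp (Finset.mem_range.mp hi)
    rw [Nat.add_sub_assoc hi, nsmul_eq_mul]
    ring
  rw [expand, map_sum, Rpoly]
  refine Finset.sum_congr rfl fun i _ => ?_
  rw [map_nsmul, coeff_xSeries_pow_mul, coeff_tSeries_pow_mul, coeff_one_add_tSeries_pow,
    show 2 * (m + 1 + i) = 2 * m + 2 * i + 2 by ring]
  split_ifs with h₁ h₂
  · rw [Nat.cast_smul_eq_nsmul, nsmul_eq_mul, nsmul_eq_mul, Nat.cast_mul,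
      ← Nat.add_sub_cancel' h₂]
    simp only [Nat.add_sub_cancel_left]
    ring
  · simp
  · simp

theorem X_sq_dvd_xSeries : PowerSeries.X ^ 2 ∣ xSeries := Dvd.intro_left _ rfl

theorem coeff_eq_zero_of_X_pow_dvd {n k : ℕ} (hnk : n < k)
    {f : PowerSeries (MvPolynomial (Fin 2) (ZMod 2))} (h : PowerSeries.X ^ k ∣ f) :
    PowerSeries.coeff n f = 0 :=
  PowerSeries.X_pow_dvd_iff.mp h n hnk

/-- `R₀` is the weight `n` part of `x / (1 + t + x)`. -/
theorem Rzero_eq_coeff (n : ℕ) {u : PowerSeries (MvPolynomial (Fin 2) (ZMod 2))}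
    (hu : (1 + tSeries + xSeries) * u = 1) :
    Rzero n = PowerSeries.coeff n (xSeries * u) := by
  have partial_sum (M : ℕ) : xSeries * u =
      ∑ j ∈ Finset.range M, xSeries ^ (j + 1) * invOneAddT ^ (j + 1) +
        xSeries ^ (M + 1) * (invOneAddT ^ M * u) := by
    induction M with
    | zero => simp
    | succ M ih =>
      rw [ih, Finset.sum_range_succ]
      linear_combination
        -xSeries ^ (M + 1) * invOneAddT ^ M * u * one_add_tSeries_mul_invOneAddT
        + xSeries ^ (M + 1) * invOneAddT ^ (M + 1) * hu
        - xSeries ^ (M + 2) * invOneAddT ^ (M + 1) * u * powerSeries_two_eq_zero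
  have remainder : PowerSeries.coeff n
      (xSeries ^ (n / 2 + 1) * (invOneAddT ^ (n / 2) * u)) = 0 := by
    rw [coeff_xSeries_pow_mul, if_neg (by omega)]
  rw [partial_sum (n / 2), map_add, remainder, add_zero, map_sum, Rzero,
    ← Finset.Ico_add_one_right_eq_Icc, Finset.sum_Ico_eq_sum_range]
  refine Finset.sum_congr (by simp) fun j hj => ?_
  have hj : 2 * (j + 1) ≤ n := by
    have := Finset.mem_range.mp hj
    omega
  rw [coeff_xSeries_pow_mul, if_pos hj, coeff_invOneAddT_pow_succ, Nat.cast_smul_eq_nsmul,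
    nsmul_eq_mul, add_comm 1 j, Nat.choose_symm_of_eq_add
      (show n - (j + 1) - 1 = (n - 2 * (j + 1)) + j by omega),
    show j + (n - 2 * (j + 1)) = n - (j + 1) - 1 by omega]
  ring

/-- For odd `n`, the weight `n` part of `x (1 + t) p` lies in `𝓡₊` for every polynomial `p` in
`(t (1 + t))²` and `x (1 + t + x)`. -/
theorem coeff_mem_Rplus {n : ℕ} (hn : Odd n)
    {p : PowerSeries (MvPolynomial (Fin 2) (ZMod 2))}
    (hp : p ∈ Algebra.adjoin (ZMod 2)
      {(tSeries * (1 + tSeries)) ^ 2, xSeries * (1 + tSeries + xSeries)}) :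
    PowerSeries.coeff n (xSeries * (1 + tSeries) * p) ∈ Rplus n := by
  rw [← Subalgebra.mem_toSubmodule, Algebra.adjoin_eq_span] at hp
  induction hp using Submodule.span_induction with
  | mem p hp =>
    obtain ⟨a, m, rfl⟩ := (Submonoid.mem_closure_pair _ _ _).mp hp
    rw [← pow_mul]
    by_cases h : 2 * a + 2 * m + 2 ≤ n - 1
    · exact Submodule.subset_span ⟨2 * a, m, h, (Rpoly_eq_coeff n (2 * a) m).symm⟩
    · obtain ⟨k, rfl⟩ := hn
      have hdvd : (PowerSeries.X ^ (2 + (2 * a + 2 * m)) :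
          PowerSeries (MvPolynomial (Fin 2) (ZMod 2))) ∣ xSeries * (1 + tSeries) *
            ((tSeries * (1 + tSeries)) ^ (2 * a) * (xSeries * (1 + tSeries + xSeries)) ^ m) := by
        rw [pow_add, pow_add, pow_mul _ 2 m]
        exact mul_dvd_mul (X_sq_dvd_xSeries.mul_right _) (mul_dvd_mul
          (pow_dvd_pow_of_dvd ((Dvd.intro_left _ rfl).mul_right _) _)
          (pow_dvd_pow_of_dvd (X_sq_dvd_xSeries.mul_right _) _))
      rw [coeff_eq_zero_of_X_pow_dvd (by omega) hdvd]
      exact zero_mem _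
  | zero => simp
  | add p q _ _ hp hq => rw [mul_add, map_add]; exact add_mem hp hq
  | smul c p _ hp =>
    rw [mul_smul_comm, PowerSeries.coeff_smul]
    exact Submodule.smul_mem _ _ hp

/-- For every odd positive integer `n`, the element `R₀` lies in `𝓡₊`. -/
theorem stmt14 (n : ℕ) (hn : Odd n) (hpos : 0 < n) : Rzero n ∈ Rplus n := by
  obtain ⟨u, hu⟩ := isUnit_one_add_tSeries_add_xSeries.exists_right_inv
  have hh := one_add_tSeries_mul_invOneAddT
  have h2 := powerSeries_two_eq_zero
  obtain ⟨p, hp, hdvd⟩ := exists_mem_adjoin_pow_dvd_sub (ZMod 2)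
    (a := (tSeries * (1 + tSeries)) ^ 2) (b := xSeries * (1 + tSeries + xSeries))
    (d := invOneAddT ^ 2) (g := invOneAddT * u) (z := PowerSeries.X)
    (dvd_pow ((Dvd.intro_left _ rfl).mul_right _) two_ne_zero)
    ((dvd_trans (dvd_pow_self _ two_ne_zero) X_sq_dvd_xSeries).mul_right _)
    (by
      generalize tSeries = t at *
      generalize invOneAddT = h at *
      linear_combination (-(t ^ 2 * h ^ 2) * ((1 + t) * h + 1) + ((1 + t) * h + 1)) * hh
        - (t * h ^ 2 + t ^ 2 * h ^ 2) * h2)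
    (by
      generalize tSeries = t at *
      generalize invOneAddT = h at *
      generalize xSeries = x at *
      linear_combination h ^ 2 * hu - h * u * hh
        - x * h ^ 2 * u * hu - x * h ^ 2 * u * h2) (n - 1)
  have hsplit : xSeries * u = xSeries * (1 + tSeries) * p +
      xSeries * (1 + tSeries) * (invOneAddT * u - p) := by
    linear_combination -xSeries * u * hh
  have hrem : (PowerSeries.X ^ (2 + (n - 1)) :
      PowerSeries (MvPolynomial (Fin 2) (ZMod 2))) ∣
        xSeries * (1 + tSeries) * (invOneAddT * u - p) := by
    rw [pow_add]
    exact mul_dvd_mul (X_sq_dvd_xSeries.mul_right _) hdvd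
  rw [Rzero_eq_coeff n hu, hsplit, map_add, coeff_eq_zero_of_X_pow_dvd (by omega) hrem, add_zero]
  exact coeff_mem_Rplus hn hp
end

section
/- Let n be a positive integer and let j be an integer with 1 ≤ j and 2j ≤ n. Then the coefficient of the monomial x^j·t^{n−2j} in the polynomial (1+t)·Σ_{k=0}^{n} (x+t)^k ∈ (ℤ/2)[x,t] equals C(n−j−1, n−2j) reduced mod 2. (This computes the part of weighted degree n of the formal power series (1+t)/(1+t+x) over ℤ/2, where x has weight 2 and t has weight 1.) -/
open MvPolynomial

theorem coeff_X_add_X_pow {R : Type*} [CommSemiring R] (a b k : ℕ) :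
    MvPolynomial.coeff (Finsupp.single 0 a + Finsupp.single 1 b)
        ((X 0 + X 1) ^ k : MvPolynomial (Fin 2) R) =
      if k = a + b then ((k.choose a : ℕ) : R) else 0 := by
  rw [coeff_add_pow]
  simp [eq_comm]

theorem coeff_sum_X_add_X_pow {R : Type*} [CommSemiring R] {a b n : ℕ} (h : a + b ≤ n) :
    MvPolynomial.coeff (Finsupp.single 0 a + Finsupp.single 1 b)
        (∑ k ∈ Finset.range (n + 1), (X 0 + X 1) ^ k : MvPolynomial (Fin 2) R) =
      (((a + b).choose a : ℕ) : R) := by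
  simp only [coeff_sum, coeff_X_add_X_pow]
  rw [Finset.sum_ite_eq', if_pos (Finset.mem_range.2 (Nat.lt_succ_of_le h))]

/-- For `1 ≤ j` and `2j ≤ n`, the coefficient of `x^j·t^(n−2j)` in
`(1+t)·Σ_{k=0}^{n} (x+t)^k ∈ (ℤ/2)[x,t]` equals `C(n−j−1, n−2j)` reduced mod `2`.
This computes the part of weighted degree `n` of the formal power series `(1+t)/(1+t+x)`
over `ℤ/2`, where `x` has weight `2` and `t` has weight `1`. -/
theorem stmt16 (n j : ℕ) (hn : 0 < n) (hj : 1 ≤ j) (hjn : 2 * j ≤ n) :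
    MvPolynomial.coeff (Finsupp.single 0 j + Finsupp.single 1 (n - 2 * j))
        ((1 + X 1) * ∑ k ∈ Finset.range (n + 1), (X 0 + X 1) ^ k :
          MvPolynomial (Fin 2) (ZMod 2)) =
      (((n - j - 1).choose (n - 2 * j) : ℕ) : ZMod 2) := by
  obtain ⟨m, rfl⟩ := Nat.exists_eq_add_of_le hjn
  obtain ⟨i, rfl⟩ := Nat.exists_eq_add_of_le' hj
  rw [show 2 * (i + 1) + m - 2 * (i + 1) = m by omega,
    show 2 * (i + 1) + m - (i + 1) - 1 = i + m by omega, add_mul, one_mul, coeff_add,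
    coeff_sum_X_add_X_pow (by omega)]
  cases m with
  | zero =>
    rw [coeff_X_mul', if_neg (by simp)]
    simp
  | succ m =>
    rw [show Finsupp.single 0 (i + 1) + Finsupp.single 1 (m + 1) =
        Finsupp.single (1 : Fin 2) 1 + (Finsupp.single 0 (i + 1) + Finsupp.single 1 m) by
          rw [add_left_comm, ← Finsupp.single_add, add_comm 1 m],
      coeff_X_mul, coeff_sum_X_add_X_pow (by omega), ← Nat.choose_symm_add (a := i) (b := m + 1),
      show i + 1 + (m + 1) = i + (m + 1) + 1 by omega, show i + 1 + m = i + (m + 1) by omega,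
      Nat.choose_succ_succ, Nat.cast_add, add_assoc, CharTwo.add_self_eq_zero, add_zero]
end

section
/- Let n ≥ 2 be an integer. Then for every integer j with 1 ≤ j ≤ n/2, the monomial w₁^{n−2j}·w₂^j lies in the ℤ/2-linear span of {w₁ⁿ} ∪ {R_m : 0 < m ≤ n/2} inside (ℤ/2)[w₁,w₂]. Consequently every monomial of weighted degree n in w₁, w₂ depends linearly on w₁ⁿ and the elements R_m. -/
open MvPolynomial

/-- The Dold-relation polynomial
`R_m = Σ_{j=0}^{m} c(n−2m−1−j, 2m−2j)·w₁^(n−2j)·w₂^j ∈ (ℤ/2)[w₁, w₂]`, where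
`c(α, β)` is the generalized ("analytic") binomial coefficient `α(α−1)⋯(α−β+1)/β!` for
`α ∈ ℤ`, `β ∈ ℕ` (here `Ring.choose` on `ℤ`), the coefficients being reduced mod `2`.
We realize `(ℤ/2)[w₁, w₂]` as `MvPolynomial (Fin 2) (ZMod 2)` with `w₁ = X 0`, `w₂ = X 1`. -/
noncomputable def DoldRel (n m : ℕ) : MvPolynomial (Fin 2) (ZMod 2) :=
  ∑ j ∈ Finset.range (m + 1),
    ((Ring.choose ((n : ℤ) - 2 * m - 1 - j) (2 * m - 2 * j) : ℤ) : ZMod 2) •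
      (X 0 ^ (n - 2 * j) * X 1 ^ j)

/-- The relation `R_m` is the monomial `w₁^(n−2m)·w₂^m` plus a combination of the monomials
with smaller exponent of `w₂`. -/
lemma DoldRel_eq_sum_add_monomial (n m : ℕ) :
    DoldRel n m = ∑ j ∈ Finset.range m,
      ((Ring.choose ((n : ℤ) - 2 * m - 1 - j) (2 * m - 2 * j) : ℤ) : ZMod 2) •
        (X 0 ^ (n - 2 * j) * X 1 ^ j) + X 0 ^ (n - 2 * m) * X 1 ^ m := by
  simp [DoldRel, Finset.sum_range_succ]

/-- A submodule containing `w₁^n` and all the relations `R_m` contains every monomial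
`w₁^(n−2j)·w₂^j`. -/
lemma monomial_mem_of_DoldRel_mem (n : ℕ)
    (S : Submodule (ZMod 2) (MvPolynomial (Fin 2) (ZMod 2))) (h0 : X 0 ^ n ∈ S)
    (hS : ∀ m : ℕ, 0 < m → 2 * m ≤ n → DoldRel n m ∈ S) (j : ℕ) (hj : 2 * j ≤ n) :
    X 0 ^ (n - 2 * j) * X 1 ^ j ∈ S := by
  induction j using Nat.strong_induction_on with
  | _ j ih =>
    rcases Nat.eq_zero_or_pos j with rfl | hpos
    · simpa using h0
    · refine (S.add_mem_iff_right (Submodule.sum_mem S fun i hi => S.smul_mem _ ?_)).mp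
        (DoldRel_eq_sum_add_monomial n j ▸ hS j hpos hj)
      have hij := Finset.mem_range.mp hi
      exact ih i hij (by omega)

/-- Let `n ≥ 2`.  Every monomial `w₁^(n−2j)·w₂^j` with `1 ≤ j ≤ n/2` lies in the
`ℤ/2`-linear span of `{w₁^n} ∪ {R_m : 0 < m ≤ n/2}` in `(ℤ/2)[w₁, w₂]`; consequently every
monomial of weighted degree `n` in `w₁, w₂` (weights `1` and `2`) depends linearly on `w₁^n`
and the elements `R_m`. -/
theorem stmt19 (n : ℕ) (hn : 2 ≤ n) :
    (∀ j : ℕ, 1 ≤ j → 2 * j ≤ n →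
      X 0 ^ (n - 2 * j) * X 1 ^ j ∈
        Submodule.span (ZMod 2)
          ({(X 0 ^ n : MvPolynomial (Fin 2) (ZMod 2))} ∪
            {p | ∃ m : ℕ, 0 < m ∧ 2 * m ≤ n ∧ p = DoldRel n m})) ∧
    (∀ a b : ℕ, a + 2 * b = n →
      X 0 ^ a * X 1 ^ b ∈
        Submodule.span (ZMod 2)
          ({(X 0 ^ n : MvPolynomial (Fin 2) (ZMod 2))} ∪
            {p | ∃ m : ℕ, 0 < m ∧ 2 * m ≤ n ∧ p = DoldRel n m})) := by
  have key := monomial_mem_of_DoldRel_mem n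
    (Submodule.span (ZMod 2)
      ({(X 0 ^ n : MvPolynomial (Fin 2) (ZMod 2))} ∪
        {p | ∃ m : ℕ, 0 < m ∧ 2 * m ≤ n ∧ p = DoldRel n m}))
    (Submodule.subset_span (Or.inl rfl))
    (fun m hm hmn => Submodule.subset_span (Or.inr ⟨m, hm, hmn, rfl⟩))
  refine ⟨fun j _ hj => key j hj, fun a b hab => ?_⟩
  obtain rfl : a = n - 2 * b := by omega
  exact key b (by omega)
end
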